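/- k[D] has the WLP if and only if A has the WLP; k[L] has the WLP if and only if B has the WLP; and R[T]/I_C has the WLP if and only if C has the WLP. -/

import Mathlib

open MvPolynomial

set_option synthInstance.maxHeartbeats 1000000
set_option maxHeartbeats 1000000

noncomputable section

namespace SRWLP

variable (k : Type) [Field k]

/-- An (abstract) simplicial complex on the vertex set `Fin n`:
a collection of finite subsets (faces) closed under passing to subsets. -/
structure SC (n : ℕ) where
  faces : Finset (Finset (Fin n))
  down_closed : ∀ s ∈ faces, ∀ t ⊆ s, t ∈ faces

variable {n : ℕ}

/-- `dimP D = dim D + 1`, i.e. the maximal cardinality of a face of `D`. -/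
def dimP (D : SC n) : ℕ := D.faces.sup Finset.card

/-- The Stanley–Reisner ideal of `D`: the ideal generated by the squarefree
monomials corresponding to non-faces. -/
def srIdeal (D : SC n) : Ideal (MvPolynomial (Fin n) k) :=
  Ideal.span { p | ∃ s : Finset (Fin n), s ∉ D.faces ∧ p = ∏ i ∈ s, X i }

/-- `x_σ`, the product of the variables indexed by the face `σ`. -/
def xFace (σ : Finset (Fin n)) : MvPolynomial (Fin n) k := ∏ i ∈ σ, X i

variable {ι : Type} [Fintype ι]

/-- The degree-`m` graded component of the standard graded algebra
`k[Xᵢ : i ∈ ι] ⧸ J`, as a `k`-submodule. -/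
def qComp (J : Ideal (MvPolynomial ι k)) (m : ℕ) :
    Submodule k (MvPolynomial ι k ⧸ J) :=
  (homogeneousSubmodule ι k m).map (Ideal.Quotient.mkₐ k J).toLinearMap

/-- Graded components indexed by `ℤ` (zero in negative degrees). -/
def qCompZ (J : Ideal (MvPolynomial ι k)) (m : ℤ) :
    Submodule k (MvPolynomial ι k ⧸ J) :=
  if 0 ≤ m then qComp k J m.toNat else ⊥

/-- The Hilbert function of `k[Xᵢ] ⧸ J`. -/
def HFq (J : Ideal (MvPolynomial ι k)) (m : ℕ) : ℕ := Module.finrank k (qComp k J m)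

/-- The Hilbert function, with `ℤ` argument. -/
def HFZ (J : Ideal (MvPolynomial ι k)) (m : ℤ) : ℕ := Module.finrank k (qCompZ k J m)

/-- A property `P` of tuples `c : τ → k` holds *generically* (i.e. for all choices
in a suitable nonempty Zariski-open subset of the affine space `k^τ`) if there is a
nonzero polynomial `g` such that `P c` holds whenever `g` does not vanish at `c`. -/
def Generic (τ : Type) (P : (τ → k) → Prop) : Prop :=
  ∃ g : MvPolynomial τ k, g ≠ 0 ∧ ∀ c : τ → k, eval c g ≠ 0 → P c

/-- The linear form with coefficient tuple `c`. -/
def linForm (c : ι → k) : MvPolynomial ι k := ∑ i, C (c i) * X i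

/-- The ideal `J` together with the `d` linear forms encoded by `c`. -/
def redIdeal (J : Ideal (MvPolynomial ι k)) {d : ℕ} (c : Fin d × ι → k) :
    Ideal (MvPolynomial ι k) :=
  J ⊔ Ideal.span (Set.range fun j : Fin d => linForm k fun i => c (j, i))

/-- `depth (k[Xᵢ]⧸J) ≥ t` : there is a regular sequence of length `t` consisting of
elements of the graded maximal ideal. -/
def depthGE (J : Ideal (MvPolynomial ι k)) (t : ℕ) : Prop :=
  ∃ rs : List (MvPolynomial ι k), rs.length = t ∧
    (∀ f ∈ rs, f ∈ Ideal.span (Set.range (X : ι → MvPolynomial ι k))) ∧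
    RingTheory.Sequence.IsRegular (MvPolynomial ι k ⧸ J)
      (rs.map (Ideal.Quotient.mk J))

/-- `k[Xᵢ]⧸J` is Cohen–Macaulay of Krull dimension `d`. -/
def isCM (J : Ideal (MvPolynomial ι k)) (d : ℕ) : Prop :=
  ringKrullDim (MvPolynomial ι k ⧸ J) = (d : ℕ) ∧ depthGE k J d

/-- The socle of `k[Xᵢ]⧸J` (the annihilator of the graded maximal ideal). -/
def socle (J : Ideal (MvPolynomial ι k)) : Submodule k (MvPolynomial ι k ⧸ J) :=
  ⨅ i : ι, LinearMap.ker (LinearMap.mulLeft k (Ideal.Quotient.mk J (X i)))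

/-- `k[Xᵢ]⧸J` is Artinian Gorenstein: Artinian with one-dimensional socle. -/
def artGor (J : Ideal (MvPolynomial ι k)) : Prop :=
  IsArtinianRing (MvPolynomial ι k ⧸ J) ∧ Module.finrank k (socle k J) = 1

/-- `k[Xᵢ]⧸J` is Gorenstein of Krull dimension `d`: it is Cohen–Macaulay of
dimension `d` and a general Artinian reduction is Artinian Gorenstein. -/
def isGor (J : Ideal (MvPolynomial ι k)) (d : ℕ) : Prop :=
  isCM k J d ∧ Generic k (Fin d × ι) fun c => artGor k (redIdeal k J c)

/-- Multiplication by `ω` from the degree-`m` component to the degree-`(m+1)`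
component of `k[Xᵢ]⧸J` has maximal rank (is injective or surjective). -/
def mulMaxRank (J : Ideal (MvPolynomial ι k)) (ω : MvPolynomial ι k ⧸ J) (m : ℕ) : Prop :=
  (∀ x ∈ qComp k J m, ω * x = 0 → x = 0) ∨
  (∀ y ∈ qComp k J (m + 1), ∃ x ∈ qComp k J m, ω * x = y)

/-- The Weak Lefschetz Property for the Artinian algebra `k[Xᵢ]⧸J`: for a general
linear form `ω`, multiplication `ω : (⧸J)ₘ → (⧸J)ₘ₊₁` has maximal rank for all `m`. -/
def artWLP (J : Ideal (MvPolynomial ι k)) : Prop :=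
  Generic k ι fun c => ∀ m : ℕ,
    mulMaxRank k J (Ideal.Quotient.mk J (linForm k c)) m

/-- The Weak Lefschetz Property for `k[Xᵢ]⧸J` of Krull dimension `d ≥ 1`:
Cohen–Macaulay, and a general Artinian reduction has the WLP. -/
def hasWLP (J : Ideal (MvPolynomial ι k)) (d : ℕ) : Prop :=
  isCM k J d ∧ Generic k (Fin d × ι) fun c => artWLP k (redIdeal k J c)

/-- The Strong Lefschetz Property for the Artinian algebra `k[Xᵢ]⧸J`. -/
def artSLP (J : Ideal (MvPolynomial ι k)) : Prop :=
  ∃ r : ℕ, qComp k J r ≠ ⊥ ∧ (∀ j : ℕ, r < j → qComp k J j = ⊥) ∧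
    (∀ i ≤ r, HFq k J i = HFq k J (r - i)) ∧
    Generic k ι fun c => ∀ i : ℕ, 2 * i ≤ r →
      (∀ x ∈ qComp k J i,
          Ideal.Quotient.mk J (linForm k c) ^ (r - 2 * i) * x = 0 → x = 0) ∧
      (∀ y ∈ qComp k J (r - i), ∃ x ∈ qComp k J i,
          Ideal.Quotient.mk J (linForm k c) ^ (r - 2 * i) * x = y)

/-- The Strong Lefschetz Property for `k[Xᵢ]⧸J` of Krull dimension `d ≥ 1`. -/
def hasSLP (J : Ideal (MvPolynomial ι k)) (d : ℕ) : Prop :=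
  isCM k J d ∧ Generic k (Fin d × ι) fun c => artSLP k (redIdeal k J c)

/-- `D` is Gorenstein* over `k`: every element of the vertex set is a vertex,
`k[D]` is Gorenstein (of dimension `dim D + 1`), and for every vertex `i` there is a
face `τ` with `τ ∪ {i}` not a face. -/
def gorStar (D : SC n) : Prop :=
  (∀ i : Fin n, {i} ∈ D.faces) ∧
  isGor k (srIdeal k D) (dimP D) ∧
  (∀ i : Fin n, ∃ τ ∈ D.faces, insert i τ ∉ D.faces)

/-! `R[T]` is modelled as the polynomial ring in `n+1` variables, the last
variable playing the role of `T`. -/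

/-- The inclusion `R = k[x₁,…,xₙ] → R[T] = k[x₁,…,xₙ,T]`. -/
def toT : MvPolynomial (Fin n) k →ₐ[k] MvPolynomial (Fin (n + 1)) k :=
  rename Fin.castSucc

/-- The variable `T` of `R[T]`. -/
def Tv (n : ℕ) : MvPolynomial (Fin (n + 1)) k := X (Fin.last n)

/-- Extension of an ideal of `R` to `R[T]`. -/
def extI (J : Ideal (MvPolynomial (Fin n) k)) : Ideal (MvPolynomial (Fin (n + 1)) k) :=
  Ideal.map (toT k) J

/-- The ideal `T·J` of `R[T]`, for an ideal `J` of `R`. -/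
def TmulI (J : Ideal (MvPolynomial (Fin n) k)) : Ideal (MvPolynomial (Fin (n + 1)) k) :=
  Ideal.span ((fun f => Tv k n * toT k f) '' (J : Set (MvPolynomial (Fin n) k)))

/-- `I_L = (I_D : x_σ)`, the Stanley–Reisner ideal of the link of `σ` in `D`
(extended to `R`). -/
def linkIdeal (D : SC n) (σ : Finset (Fin n)) : Ideal (MvPolynomial (Fin n) k) :=
  Submodule.colon (srIdeal k D) (Ideal.span {xFace k σ})

/-- `J_st = (I, x_σ, T·I_L) ⊂ R[T]`, the Stanley–Reisner ideal of the stellar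
subdivision `D_σ`. -/
def Jst (D : SC n) (σ : Finset (Fin n)) : Ideal (MvPolynomial (Fin (n + 1)) k) :=
  extI k (srIdeal k D) ⊔ Ideal.span {toT k (xFace k σ)} ⊔ TmulI k (linkIdeal k D σ)

/-- `I_C = (I, T^{q+1}, T·I_L) ⊂ R[T]`. -/
def IC (D : SC n) (σ : Finset (Fin n)) (q : ℕ) : Ideal (MvPolynomial (Fin (n + 1)) k) :=
  extI k (srIdeal k D) ⊔ Ideal.span {Tv k n ^ (q + 1)} ⊔ TmulI k (linkIdeal k D σ)

/-- `I_G = (I, T^{q+1} - x_σ, T·I_L) ⊂ R[T]`. -/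
def IG (D : SC n) (σ : Finset (Fin n)) (q : ℕ) : Ideal (MvPolynomial (Fin (n + 1)) k) :=
  extI k (srIdeal k D) ⊔ Ideal.span {Tv k n ^ (q + 1) - toT k (xFace k σ)} ⊔
    TmulI k (linkIdeal k D σ)

/-- The ideal of `R[T]` generated by `d` general linear forms of `R`
(involving only the `x`-variables). -/
def xForms {d : ℕ} (c : Fin d × Fin n → k) : Ideal (MvPolynomial (Fin (n + 1)) k) :=
  Ideal.span (Set.range fun j : Fin d => toT k (linForm k fun i => c (j, i)))

/-- Property `M_{q,p₁}` for the Artinian algebra `B = R⧸J_B`: for a general linear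
form `ω`, multiplication by `ω^q : B_{p₁-q} → B_{p₁}` is injective. -/
def propM (JB : Ideal (MvPolynomial (Fin n) k)) (q p₁ : ℕ) : Prop :=
  Generic k (Fin n) fun c => ∀ x ∈ qCompZ k JB ((p₁ : ℤ) - (q : ℤ)),
    Ideal.Quotient.mk JB (linForm k c) ^ q * x = 0 → x = 0

section RegularElements

variable {R : Type*} [CommRing R]

/-- `a` is a nonzerodivisor on `R ⧸ J`. -/
def RegOn (J : Ideal R) (a : R) : Prop := ∀ x, a * x ∈ J → x ∈ J

/-- `l` is a weakly regular sequence on `R ⧸ J`. -/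
def RegSeq : Ideal R → List R → Prop
  | _, [] => True
  | J, a :: l => RegOn J a ∧ RegSeq (J ⊔ Ideal.span {a}) l

/-- There is a weakly regular sequence of length `t` on `R ⧸ J` with elements in `m`. -/
def DepthIn (m : Ideal R) : ℕ → Ideal R → Prop
  | 0, _ => True
  | t + 1, J => ∃ a ∈ m, RegOn J a ∧ DepthIn m t (J ⊔ Ideal.span {a})

theorem mem_sup_span_singleton' {J : Ideal R} {a x : R} :
    x ∈ J ⊔ Ideal.span {a} ↔ ∃ j ∈ J, ∃ y, x = j + a * y := by
  constructor
  · intro h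
    obtain ⟨j, hj, z, hz, rfl⟩ := Submodule.mem_sup.1 h
    obtain ⟨y, rfl⟩ := Ideal.mem_span_singleton'.1 hz
    exact ⟨j, hj, y, by ring⟩
  · rintro ⟨j, hj, y, rfl⟩
    exact add_mem (Ideal.mem_sup_left hj)
      (Ideal.mem_sup_right (Ideal.mul_mem_right _ _ (Ideal.mem_span_singleton_self a)))

theorem regOn_iff_isSMulRegular {J : Ideal R} {a : R} : RegOn J a ↔ IsSMulRegular (R ⧸ J) a := by
  rw [isSMulRegular_iff_right_eq_zero_of_smul]
  constructor
  · intro h m hm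
    obtain ⟨x, rfl⟩ := Ideal.Quotient.mk_surjective m
    rw [Ideal.Quotient.eq_zero_iff_mem]
    refine h x ?_
    rw [← Ideal.Quotient.eq_zero_iff_mem, ← hm]
    rfl
  · intro h x hx
    rw [← Ideal.Quotient.eq_zero_iff_mem]
    refine h _ ?_
    rw [← Ideal.Quotient.eq_zero_iff_mem] at hx
    rw [← hx]
    rfl

open scoped Pointwise in
theorem regSeq_iff_isWeaklyRegular {J : Ideal R} {l : List R} :
    RegSeq J l ↔ RingTheory.Sequence.IsWeaklyRegular (R ⧸ J) l := by
  induction l generalizing J with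
  | nil => simp [RegSeq]
  | cons a l ih =>
    rw [RegSeq, RingTheory.Sequence.isWeaklyRegular_cons_iff, regOn_iff_isSMulRegular, ih]
    refine and_congr_right fun _ => ?_
    have h : (a • ⊤ : Submodule R (R ⧸ J)) = Submodule.map J.mkQ (Ideal.span {a}) := by
      ext x
      rw [Submodule.mem_smul_pointwise_iff_exists, Submodule.mem_map]
      constructor
      · rintro ⟨b, -, rfl⟩
        obtain ⟨y, rfl⟩ := Submodule.mkQ_surjective _ b
        exact ⟨a * y, Ideal.mul_mem_right _ _ (Ideal.mem_span_singleton_self a), by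
          rw [← map_smul]; rfl⟩
      · rintro ⟨y, hy, rfl⟩
        obtain ⟨z, rfl⟩ := Ideal.mem_span_singleton'.1 hy
        exact ⟨J.mkQ z, trivial, by rw [← map_smul, smul_eq_mul, mul_comm]⟩
    exact (LinearEquiv.isWeaklyRegular_congr
      ((Submodule.quotEquivOfEq _ _ h).trans
        (Submodule.quotientQuotientEquivQuotientSup J (Ideal.span {a}))) l).symm

theorem RegSeq.depthIn {m J : Ideal R} {l : List R} (h : RegSeq J l) (hl : ∀ a ∈ l, a ∈ m) :
    DepthIn m l.length J := by
  induction l generalizing J with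
  | nil => trivial
  | cons a l ih =>
    exact ⟨a, hl a (by simp), h.1, ih h.2 fun b hb => hl b (by simp [hb])⟩

/-- If `a`, `c` is a regular sequence then `a` is regular modulo `c`. -/
theorem RegOn.swap {J : Ideal R} {a c : R} (ha : RegOn J a) (hc : RegOn (J ⊔ Ideal.span {a}) c) :
    RegOn (J ⊔ Ideal.span {c}) a := by
  intro x hx
  obtain ⟨j, hj, y, hy⟩ := mem_sup_span_singleton'.1 hx
  have h1 : c * y ∈ J ⊔ Ideal.span {a} :=
    mem_sup_span_singleton'.2 ⟨-j, neg_mem hj, x, by rw [hy]; ring⟩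
  obtain ⟨j', hj', z, rfl⟩ := mem_sup_span_singleton'.1 (hc _ h1)
  have h2 : a * (x - c * z) ∈ J := by
    have : a * (x - c * z) = j + c * j' := by
      rw [mul_sub, hy]; ring
    rw [this]
    exact add_mem hj (Ideal.mul_mem_left _ _ hj')
  exact mem_sup_span_singleton'.2 ⟨_, ha _ h2, z, by ring⟩

theorem DepthIn.exists_mul_notMem {m J : Ideal R} {t : ℕ} (h : DepthIn m (t + 1) J) {y : R}
    (hy : y ∉ J) : ∃ a ∈ m, a * y ∉ J := by
  obtain ⟨a, ha, har, -⟩ := h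
  exact ⟨a, ha, fun h => hy (har _ h)⟩

theorem DepthIn.quot_exists_mul_notMem {m J : Ideal R} {t : ℕ} {l : R}
    (h : DepthIn m (t + 2) J) (hlr : RegOn J l) {y : R}
    (hy : y ∉ J ⊔ Ideal.span {l}) : ∃ b ∈ m, b * y ∉ J ⊔ Ideal.span {l} := by
  by_contra! H
  obtain ⟨a, ha, har, b, hb, hbr, -⟩ := h
  obtain ⟨j, hj, y', hy'⟩ := mem_sup_span_singleton'.1 (H a ha)
  obtain ⟨j', hj', y₁, hy₁⟩ := mem_sup_span_singleton'.1 (H b hb)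
  have h1 : l * (b * y' - a * y₁) ∈ J := by
    have : l * (b * y' - a * y₁) = a * j' - b * j := by
      linear_combination (-b) * hy' + a * hy₁
    rw [this]
    exact sub_mem (Ideal.mul_mem_left _ _ hj') (Ideal.mul_mem_left _ _ hj)
  have h2 : b * y' ∈ J ⊔ Ideal.span {a} :=
    mem_sup_span_singleton'.2 ⟨_, hlr _ h1, y₁, by ring⟩
  obtain ⟨j₂, hj₂, z, rfl⟩ := mem_sup_span_singleton'.1 (hbr _ h2)
  have h3 : a * (y - l * z) ∈ J := by
    have : a * (y - l * z) = j + l * j₂ := by linear_combination hy'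
    rw [this]
    exact add_mem hj (Ideal.mul_mem_left _ _ hj₂)
  exact hy (mem_sup_span_singleton'.2 ⟨_, har _ h3, z, by ring⟩)

theorem ringKrullDim_quotient_sup_ofList_add_length_le {J : Ideal R} {l : List R}
    (h : RegSeq J l) :
    ringKrullDim (R ⧸ J ⊔ Ideal.ofList l) + l.length ≤ ringKrullDim (R ⧸ J) := by
  induction l generalizing J with
  | nil =>
    simp only [List.length_nil, Nat.cast_zero, add_zero]
    exact (ringKrullDim_eq_of_ringEquiv (Ideal.quotEquivOfEq (by simp))).le
  | cons a l ih =>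
    have h1 := ih h.2
    have ha : Ideal.Quotient.mk J a ∈ nonZeroDivisors (R ⧸ J) := by
      rw [mem_nonZeroDivisors_iff_right]
      intro x hx
      obtain ⟨y, rfl⟩ := Ideal.Quotient.mk_surjective x
      rw [Ideal.Quotient.eq_zero_iff_mem]
      refine h.1 y ?_
      rw [← Ideal.Quotient.eq_zero_iff_mem, mul_comm, map_mul, hx]
    have h2 := ringKrullDim_quotient_succ_le_of_nonZeroDivisor ha
    have e : ((R ⧸ J) ⧸ Ideal.span {Ideal.Quotient.mk J a}) ≃+* (R ⧸ J ⊔ Ideal.span {a}) :=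
      (Ideal.quotEquivOfEq (by rw [Ideal.map_span, Set.image_singleton])).trans
        (DoubleQuot.quotQuotEquivQuotSup J (Ideal.span {a}))
    rw [ringKrullDim_eq_of_ringEquiv e] at h2
    rw [Ideal.ofList_cons, ← sup_assoc, List.length_cons, Nat.cast_add, Nat.cast_one, ← add_assoc]
    exact (add_le_add_left h1 1).trans h2

end RegularElements

section LinearForms

variable {k}

/-- The ideal generated by the variables. -/
def irrel (k ι : Type) [Field k] : Ideal (MvPolynomial ι k) :=
  Ideal.span (Set.range (X : ι → MvPolynomial ι k))

theorem linForm_mem_irrel (c : ι → k) : linForm k c ∈ irrel k ι :=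
  Ideal.sum_mem _ fun i _ => Ideal.mul_mem_left _ _ (Ideal.subset_span ⟨i, rfl⟩)

theorem linForm_add (c e : ι → k) : linForm k (c + e) = linForm k c + linForm k e := by
  simp [linForm, add_mul, Finset.sum_add_distrib]

theorem linForm_smul (a : k) (c : ι → k) : linForm k (a • c) = C a * linForm k c := by
  simp [linForm, Finset.mul_sum, mul_assoc]

theorem linForm_single [DecidableEq ι] (i : ι) : linForm k (Pi.single i 1) = X i := by
  rw [linForm, Finset.sum_eq_single i] <;> simp +contextual

theorem exists_X_mul_notMem {J : Ideal (MvPolynomial ι k)} {y : MvPolynomial ι k}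
    (h : ∃ a ∈ irrel k ι, a * y ∉ J) : ∃ i, X i * y ∉ J := by
  by_contra! H
  obtain ⟨a, ha, hay⟩ := h
  have : irrel k ι ≤ Submodule.colon J (Ideal.span {y}) := by
    rw [irrel, Ideal.span_le]
    rintro _ ⟨i, rfl⟩
    exact Ideal.mem_colon_span_singleton.2 (H i)
  exact hay (Ideal.mem_colon_span_singleton.1 (this ha))

/-- Prime avoidance for linear forms supported on a set of variables. -/
theorem exists_linForm_regOn [Infinite k] (S : Set ι) (Js : List (Ideal (MvPolynomial ι k)))
    (h : ∀ J ∈ Js, ∀ y, y ∉ J → ∃ i ∈ S, X i * y ∉ J) :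
    ∃ c : ι → k, (∀ i, i ∉ S → c i = 0) ∧ ∀ J ∈ Js, RegOn J (linForm k c) := by
  classical
  let r : (ι → k) →ₗ[k] MvPolynomial ι k :=
    { toFun := fun c => linForm k fun i => if i ∈ S then c i else 0
      map_add' := fun c e => by
        rw [← linForm_add]; congr 1; ext i; by_cases hi : i ∈ S <;> simp [hi]
      map_smul' := fun a c => by
        rw [RingHom.id_apply, smul_eq_C_mul, ← linForm_smul]; congr 1; ext i
        by_cases hi : i ∈ S <;> simp [hi] }
  let s : Set (Subspace k (ι → k)) := ⋃ J ∈ {J | J ∈ Js},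
    (fun P : Ideal (MvPolynomial ι k) => (P.restrictScalars k).comap r) ''
      associatedPrimes (MvPolynomial ι k) (MvPolynomial ι k ⧸ J)
  have hs : s.Finite := by
    refine Set.Finite.biUnion (List.finite_toSet Js) fun J _ => Set.Finite.image _ ?_
    exact associatedPrimes.finite _ _
  have htop : (⊤ : Subspace k (ι → k)) ∉ hs.toFinset := by
    intro ht
    simp only [s, Set.Finite.mem_toFinset, Set.mem_iUnion, Set.mem_image] at ht
    obtain ⟨J, hJ, P, hP, hPt⟩ := ht
    obtain ⟨hPp, y, hy⟩ := isAssociatedPrime_iff.1 hP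
    obtain ⟨y, rfl⟩ := Ideal.Quotient.mk_surjective y
    have key : ∀ x, x ∈ P ↔ x * y ∈ J := by
      intro x
      rw [hy, Submodule.mem_colon_singleton, Submodule.mem_bot, ← Ideal.Quotient.eq_zero_iff_mem]
      rfl
    have hyJ : y ∉ J := fun hyJ => hPp.ne_top ((Ideal.eq_top_iff_one _).2 ((key 1).2 (by simpa)))
    obtain ⟨i, hi, hiy⟩ := h J hJ y hyJ
    refine hiy ((key _).1 ?_)
    have : (Pi.single i 1 : ι → k) ∈ (P.restrictScalars k).comap r := hPt ▸ trivial
    have h2 : r (Pi.single i 1) = X i := by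
      rw [← linForm_single (k := k) i]
      change linForm k _ = _
      congr 1; ext j
      by_cases hj : j = i
      · subst hj; simp [hi]
      · simp [hj]
    simpa [h2] using this
  obtain ⟨c, hc⟩ := (Set.ne_univ_iff_exists_notMem _).1
    (Subspace.biUnion_ne_univ_of_top_notMem htop)
  refine ⟨fun i => if i ∈ S then c i else 0, fun i hi => by simp [hi], fun J hJ => ?_⟩
  rw [regOn_iff_isSMulRegular]
  by_contra hreg
  have hmem : (linForm k fun i => if i ∈ S then c i else 0) ∈
      ⋃ p ∈ associatedPrimes (MvPolynomial ι k) (MvPolynomial ι k ⧸ J),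
        (p : Set (MvPolynomial ι k)) := by
    rw [biUnion_associatedPrimes_eq_compl_regular]
    exact hreg
  simp only [Set.mem_iUnion] at hmem
  obtain ⟨P, hP, hcP⟩ := hmem
  refine hc ?_
  simp only [Set.mem_iUnion]
  refine ⟨(P.restrictScalars k).comap r, ?_, hcP⟩
  rw [Set.Finite.mem_toFinset]
  simp only [s, Set.mem_iUnion]
  exact ⟨J, hJ, P, hP, rfl⟩

/-- Depth drops by exactly one modulo any regular element of the irrelevant ideal. -/
theorem DepthIn.quot [Infinite k] {t : ℕ} {J : Ideal (MvPolynomial ι k)} {l : MvPolynomial ι k}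
    (h : DepthIn (irrel k ι) (t + 1) J) (hl : l ∈ irrel k ι) (hlr : RegOn J l) :
    DepthIn (irrel k ι) t (J ⊔ Ideal.span {l}) := by
  induction t generalizing J l with
  | zero => trivial
  | succ t ih =>
    obtain ⟨a, ha, har, had⟩ := id h
    obtain ⟨c, -, hc⟩ := exists_linForm_regOn Set.univ
      [J ⊔ Ideal.span {a}, J ⊔ Ideal.span {l}] (by
        intro J' hJ' y hy
        suffices ∃ i, X i * y ∉ J' by simpa using this
        refine exists_X_mul_notMem ?_
        simp only [List.mem_cons, List.not_mem_nil, or_false] at hJ'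
        rcases hJ' with rfl | rfl
        · exact had.exists_mul_notMem hy
        · exact h.quot_exists_mul_notMem hlr hy)
    have hca : RegOn (J ⊔ Ideal.span {a}) (linForm k c) := hc _ (by simp)
    have hcl : RegOn (J ⊔ Ideal.span {l}) (linForm k c) := hc _ (by simp)
    have hcm := linForm_mem_irrel (k := k) c
    have h1 := ih had hcm hca
    rw [sup_right_comm] at h1
    have h2 : DepthIn (irrel k ι) (t + 1) (J ⊔ Ideal.span {linForm k c}) :=
      ⟨a, ha, har.swap hca, h1⟩
    have h3 := ih h2 hl (hlr.swap hcl)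
    rw [sup_right_comm] at h3
    exact ⟨_, hcm, hcl, h3⟩

/-- Two quotients of depth at least `t` have a common regular sequence of `t` linear forms. -/
theorem exists_linForm_regSeq [Infinite k] {t : ℕ} {J₁ J₂ : Ideal (MvPolynomial ι k)}
    (h₁ : DepthIn (irrel k ι) t J₁) (h₂ : DepthIn (irrel k ι) t J₂) :
    ∃ cs : List (ι → k), cs.length = t ∧ RegSeq J₁ (cs.map (linForm k)) ∧
      RegSeq J₂ (cs.map (linForm k)) := by
  induction t generalizing J₁ J₂ with
  | zero => exact ⟨[], rfl, trivial, trivial⟩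
  | succ t ih =>
    obtain ⟨c, -, hc⟩ := exists_linForm_regOn Set.univ [J₁, J₂] (by
        intro J' hJ' y hy
        suffices ∃ i, X i * y ∉ J' by simpa using this
        refine exists_X_mul_notMem ?_
        simp only [List.mem_cons, List.not_mem_nil, or_false] at hJ'
        rcases hJ' with rfl | rfl
        · exact h₁.exists_mul_notMem hy
        · exact h₂.exists_mul_notMem hy)
    have hc₁ : RegOn J₁ (linForm k c) := hc _ (by simp)
    have hc₂ : RegOn J₂ (linForm k c) := hc _ (by simp)
    obtain ⟨cs, hl, hr₁, hr₂⟩ := ih (h₁.quot (linForm_mem_irrel c) hc₁)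
      (h₂.quot (linForm_mem_irrel c) hc₂)
    exact ⟨c :: cs, by simp [hl], ⟨hc₁, hr₁⟩, ⟨hc₂, hr₂⟩⟩

theorem depthGE_iff_exists_regSeq {J : Ideal (MvPolynomial ι k)} (hJ : J ≤ irrel k ι) {t : ℕ} :
    depthGE k J t ↔ ∃ l : List (MvPolynomial ι k), l.length = t ∧ (∀ a ∈ l, a ∈ irrel k ι) ∧
      RegSeq J l := by
  refine exists_congr fun l => and_congr_right fun _ => and_congr_right fun hl => ?_
  have h1 : RegSeq J l ↔ RingTheory.Sequence.IsWeaklyRegular (MvPolynomial ι k ⧸ J)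
      (l.map (Ideal.Quotient.mk J)) := by
    rw [regSeq_iff_isWeaklyRegular]
    exact (RingTheory.Sequence.isWeaklyRegular_map_algebraMap_iff (MvPolynomial ι k ⧸ J) _ l).symm
  rw [h1]
  refine ⟨fun h => h.1, fun h => ⟨h, fun htop => ?_⟩⟩
  have hle : Ideal.ofList (l.map (Ideal.Quotient.mk J)) ≤ (irrel k ι).map (Ideal.Quotient.mk J) := by
    rw [← Ideal.map_ofList]
    exact Ideal.map_mono (Ideal.span_le.2 hl)
  have h2 : (1 : MvPolynomial ι k ⧸ J) ∈ (irrel k ι).map (Ideal.Quotient.mk J) := by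
    refine hle ?_
    have : (1 : MvPolynomial ι k ⧸ J) ∈ (⊤ : Submodule (MvPolynomial ι k ⧸ J) _) := trivial
    rw [htop] at this
    simpa using this
  rw [← map_one (Ideal.Quotient.mk J), Ideal.mem_quotient_iff_mem hJ] at h2
  have h3 : irrel k ι ≤ RingHom.ker (constantCoeff : MvPolynomial ι k →+* k) := by
    rw [irrel, Ideal.span_le]
    rintro _ ⟨i, rfl⟩
    simp
  simpa using h3 h2

end LinearForms

section Homogeneous

variable {k}

/-- `J` is a homogeneous ideal. -/
def Homog (J : Ideal (MvPolynomial ι k)) : Prop :=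
  ∀ p ∈ J, ∀ m, homogeneousComponent m p ∈ J

theorem Homog.sup {J K : Ideal (MvPolynomial ι k)} (hJ : Homog J) (hK : Homog K) :
    Homog (J ⊔ K) := by
  intro p hp m
  obtain ⟨a, ha, b, hb, rfl⟩ := Submodule.mem_sup.1 hp
  rw [map_add]
  exact add_mem (Ideal.mem_sup_left (hJ a ha m)) (Ideal.mem_sup_right (hK b hb m))

theorem homog_span {s : Set (MvPolynomial ι k)} (hs : ∀ p ∈ s, ∃ m, p.IsHomogeneous m) :
    Homog (Ideal.span s) := by
  let _ := gradedAlgebra (σ := ι) (R := k)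
  intro p hp m
  exact homogeneousComponent_mem_of_mem
    (Ideal.homogeneous_span (homogeneousSubmodule ι k) s hs) hp m

theorem isHomogeneous_linForm (c : ι → k) : (linForm k c).IsHomogeneous 1 :=
  IsHomogeneous.sum _ _ _ fun i _ => by
    simpa using (isHomogeneous_C ι (c i)).mul (isHomogeneous_X k i)

theorem homog_span_linForm (c : ι → k) : Homog (Ideal.span {linForm k c}) :=
  homog_span fun p hp => ⟨1, by rw [Set.mem_singleton_iff.1 hp]; exact isHomogeneous_linForm c⟩

theorem Homog.redIdeal {J : Ideal (MvPolynomial ι k)} (hJ : Homog J) {d : ℕ}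
    (c : Fin d × ι → k) : Homog (redIdeal k J c) :=
  hJ.sup (homog_span fun p hp => by
    obtain ⟨j, rfl⟩ := hp
    exact ⟨1, isHomogeneous_linForm _⟩)

theorem homogeneousComponent_mul_of_isHomogeneous {l : MvPolynomial ι k} {s : ℕ}
    (hl : l.IsHomogeneous s) (p : MvPolynomial ι k) (m : ℕ) :
    homogeneousComponent (m + s) (l * p) = l * homogeneousComponent m p := by
  conv_lhs => rw [← sum_homogeneousComponent p, Finset.mul_sum, map_sum]
  have h : ∀ i, homogeneousComponent (m + s) (l * homogeneousComponent i p) =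
      if i = m then l * homogeneousComponent m p else 0 := by
    intro i
    rw [homogeneousComponent_of_mem (hl.mul (homogeneousComponent_isHomogeneous i p))]
    by_cases hi : i = m
    · subst hi; simp [add_comm]
    · rw [if_neg (by omega), if_neg hi]
  rw [Finset.sum_congr rfl fun i _ => h i]
  simp only [Finset.sum_ite_eq', Finset.mem_range, ite_eq_left_iff, not_lt]
  intro hm
  rw [homogeneousComponent_eq_zero m p (by omega), mul_zero]

theorem homogeneousComponent_mul_eq_zero {l : MvPolynomial ι k} {s : ℕ}
    (hl : l.IsHomogeneous s) (p : MvPolynomial ι k) {m : ℕ} (hm : m < s) :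
    homogeneousComponent m (l * p) = 0 := by
  conv_lhs => rw [← sum_homogeneousComponent p, Finset.mul_sum, map_sum]
  refine Finset.sum_eq_zero fun i _ => ?_
  rw [homogeneousComponent_of_mem (hl.mul (homogeneousComponent_isHomogeneous i p)),
    if_neg (by omega)]

theorem Homog.mem_of_forall_pow {J : Ideal (MvPolynomial ι k)} (hJ : Homog J) {c : ι → k}
    {y : MvPolynomial ι k} (h : ∀ s, ∃ z, y - linForm k c ^ s * z ∈ J) : y ∈ J := by
  rw [← sum_homogeneousComponent y]
  refine Ideal.sum_mem _ fun m _ => ?_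
  obtain ⟨z, hz⟩ := h (m + 1)
  have hl : (linForm k c ^ (m + 1)).IsHomogeneous (m + 1) := by
    simpa using (isHomogeneous_linForm c).pow (m + 1)
  simpa [homogeneousComponent_mul_eq_zero hl z (Nat.lt_succ_self m)] using hJ _ hz m

/-- If `R ⧸ J` has depth at least two then no associated prime contains all variables but one. -/
theorem Homog.exists_X_mul_notMem_of_ne [Infinite k] {J : Ideal (MvPolynomial ι k)}
    (hJ : Homog J) {t : ℕ} (h : DepthIn (irrel k ι) (t + 2) J) (i : ι)
    {y : MvPolynomial ι k} (hy : y ∉ J) : ∃ j ∈ ({i}ᶜ : Set ι), X j * y ∉ J := by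
  classical
  by_contra! H
  obtain ⟨c, -, hc⟩ := exists_linForm_regOn Set.univ [J] (by
    intro J' hJ' z hz
    obtain rfl : J' = J := by simpa using hJ'
    simpa using exists_X_mul_notMem (h.exists_mul_notMem hz))
  have hcr : RegOn J (linForm k c) := hc _ (by simp)
  have hd := h.quot (linForm_mem_irrel c) hcr
  have hsplit : ∀ z, linForm k c * z =
      C (c i) * (X i * z) + ∑ j ∈ Finset.univ.erase i, C (c j) * (X j * z) := by
    intro z
    rw [Finset.add_sum_erase _ (fun j => C (c j) * (X j * z)) (Finset.mem_univ i), linForm,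
      Finset.sum_mul]
    simp only [mul_assoc]
  have hsum : ∀ z, (∀ j ∈ ({i}ᶜ : Set ι), X j * z ∈ J) →
      ∑ j ∈ Finset.univ.erase i, C (c j) * (X j * z) ∈ J := fun z hz =>
    Ideal.sum_mem _ fun j hj => Ideal.mul_mem_left _ _ (hz j (by simpa using hj))
  have hci : c i ≠ 0 := by
    intro hci
    refine hy (hcr y ?_)
    rw [hsplit, hci, map_zero, zero_mul, zero_add]
    exact hsum y H
  have step : ∀ z, (∀ j ∈ ({i}ᶜ : Set ι), X j * z ∈ J) →
      ∃ z', (∀ j ∈ ({i}ᶜ : Set ι), X j * z' ∈ J) ∧ z - linForm k c * z' ∈ J := by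
    intro z hz
    have hzm : z ∈ J ⊔ Ideal.span {linForm k c} := by
      by_contra hzn
      obtain ⟨j, hj⟩ := exists_X_mul_notMem (hd.exists_mul_notMem hzn)
      refine hj ?_
      by_cases hji : j = i
      · subst hji
        have : X j * z = -C (c j)⁻¹ * (∑ j' ∈ Finset.univ.erase j, C (c j') * (X j' * z)) +
            linForm k c * (C (c j)⁻¹ * z) := by
          have e : C (c j)⁻¹ * C (c j) = (1 : MvPolynomial ι k) := by
            rw [← C_mul, inv_mul_cancel₀ hci, C_1]
          linear_combination (-C (c j)⁻¹) * hsplit z - (X j * z) * e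
        exact mem_sup_span_singleton'.2 ⟨_, Ideal.mul_mem_left _ _ (hsum z hz), _, this⟩
      · exact Ideal.mem_sup_left (hz j hji)
    obtain ⟨a, ha, z', rfl⟩ := mem_sup_span_singleton'.1 hzm
    refine ⟨z', fun j hj => hcr _ ?_, by simpa using ha⟩
    have : linForm k c * (X j * z') = X j * (a + linForm k c * z') - X j * a := by ring
    rw [this]
    exact sub_mem (hz j hj) (Ideal.mul_mem_left _ _ ha)
  refine hy (hJ.mem_of_forall_pow (c := c) fun s => ?_)
  suffices ∃ z, (∀ j ∈ ({i}ᶜ : Set ι), X j * z ∈ J) ∧ y - linForm k c ^ s * z ∈ J from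
    ⟨this.choose, this.choose_spec.2⟩
  induction s with
  | zero => exact ⟨y, H, by simp⟩
  | succ s ih =>
    obtain ⟨z, hz, hyz⟩ := ih
    obtain ⟨z', hz', hzz⟩ := step z hz
    refine ⟨z', hz', ?_⟩
    have : y - linForm k c ^ (s + 1) * z' =
        (y - linForm k c ^ s * z) + linForm k c ^ s * (z - linForm k c * z') := by ring
    rw [this]
    exact add_mem hyz (Ideal.mul_mem_left _ _ hzz)

/-- All but one of the linear forms in a regular sequence can be chosen free of a given variable. -/
theorem Homog.exists_linForm_regSeq_free [Infinite k] {J : Ideal (MvPolynomial ι k)}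
    (hJ : Homog J) {t : ℕ} (h : DepthIn (irrel k ι) (t + 1) J) (i : ι) :
    ∃ cs : List (ι → k), cs.length = t ∧ (∀ c ∈ cs, c i = 0) ∧
      RegSeq J (cs.map (linForm k)) := by
  induction t generalizing J with
  | zero => exact ⟨[], rfl, by simp, trivial⟩
  | succ t ih =>
    obtain ⟨c, hci, hc⟩ := exists_linForm_regOn {i}ᶜ [J] (by
      intro J' hJ' y hy
      obtain rfl : J' = J := by simpa using hJ'
      exact hJ.exists_X_mul_notMem_of_ne h i hy)
    have hcr : RegOn J (linForm k c) := hc _ (by simp)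
    obtain ⟨cs, hl, hcs, hr⟩ := ih (hJ.sup (homog_span_linForm c))
      (h.quot (linForm_mem_irrel c) hcr)
    refine ⟨c :: cs, by simp [hl], ?_, hcr, hr⟩
    intro e he
    rcases List.mem_cons.1 he with rfl | he
    · exact hci i (by simp)
    · exact hcs e he

end Homogeneous

section KillVariable

variable {k}

open Classical in
/-- The substitution `X i ↦ 0`. -/
def killVar (i : ι) : MvPolynomial ι k →ₐ[k] MvPolynomial ι k :=
  aeval fun j => if j = i then 0 else X j

theorem exists_eq_killVar_add (i : ι) (p : MvPolynomial ι k) :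
    ∃ p', p = killVar i p + X i * p' := by
  induction p using MvPolynomial.induction_on with
  | C a => exact ⟨0, by simp [killVar, algebraMap_eq]⟩
  | add p q hp hq =>
    obtain ⟨p', hp⟩ := hp
    obtain ⟨q', hq⟩ := hq
    exact ⟨p' + q', by rw [map_add]; linear_combination hp + hq⟩
  | mul_X p j hp =>
    obtain ⟨p', hp⟩ := hp
    by_cases hj : j = i
    · subst hj
      exact ⟨p, by simp [killVar, mul_comm]⟩
    · refine ⟨p' * X j, ?_⟩
      have : killVar (k := k) i (X j) = X j := by simp [killVar, hj]
      rw [map_mul, this]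
      linear_combination X j * hp

theorem killVar_X_self (i : ι) : killVar (k := k) i (X i) = 0 := by simp [killVar]

theorem killVar_linForm {i : ι} {c : ι → k} (hc : c i = 0) :
    killVar i (linForm k c) = linForm k c := by
  rw [linForm, map_sum]
  refine Finset.sum_congr rfl fun j _ => ?_
  by_cases hj : j = i
  · subst hj; simp [hc]
  · simp [killVar, hj, algebraMap_eq]

/-- `J` is stable under the substitution `X i ↦ 0`. -/
def KillStable (i : ι) (J : Ideal (MvPolynomial ι k)) : Prop := ∀ p ∈ J, killVar i p ∈ J

variable {i : ι} {J J' : Ideal (MvPolynomial ι k)} {f : MvPolynomial ι k}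

theorem KillStable.sup (hJ : KillStable i J) (hf : killVar i f = f) :
    KillStable i (J ⊔ Ideal.span {f}) := by
  intro p hp
  obtain ⟨j, hj, z, rfl⟩ := mem_sup_span_singleton'.1 hp
  exact mem_sup_span_singleton'.2 ⟨_, hJ j hj, killVar i z, by rw [map_add, map_mul, hf]⟩

theorem KillStable.exists_eq_add (hJ : KillStable i J) (hf : killVar i f = f)
    {y : MvPolynomial ι k} (hy : X i * y ∈ J ⊔ Ideal.span {f}) :
    ∃ j z, X i * j ∈ J ∧ y = j + f * z := by
  obtain ⟨j, hj, z, hyz⟩ := mem_sup_span_singleton'.1 hy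
  obtain ⟨j', hj'⟩ := exists_eq_killVar_add i j
  obtain ⟨z', hz'⟩ := exists_eq_killVar_add i z
  have h0 : 0 = killVar i j + f * killVar i z := by
    have := congrArg (killVar i) hyz
    rwa [map_mul, killVar_X_self, zero_mul, map_add, map_mul, hf] at this
  refine ⟨j', z', ?_, ?_⟩
  · have : X i * j' = j - killVar i j := by linear_combination -hj'
    rw [this]
    exact sub_mem hj (hJ j hj)
  · have hX : (X i : MvPolynomial ι k) ≠ 0 := X_ne_zero i
    refine mul_left_cancel₀ hX ?_
    linear_combination hyz + hj' + f * hz' - h0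

theorem KillStable.regSeq_colon (hJ : KillStable i J) (hJ' : ∀ y, y ∈ J' ↔ X i * y ∈ J)
    {cs : List (ι → k)} (hcs : ∀ c ∈ cs, c i = 0) (h : RegSeq J (cs.map (linForm k))) :
    RegSeq J' (cs.map (linForm k)) := by
  induction cs generalizing J J' with
  | nil => trivial
  | cons c cs ih =>
    have hc := killVar_linForm (hcs c (by simp))
    refine ⟨?_, ih (hJ.sup hc) ?_ (fun e he => hcs e (by simp [he])) h.2⟩
    · intro y hy
      rw [hJ'] at hy ⊢
      refine h.1 _ ?_
      rwa [mul_left_comm]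
    · intro y
      constructor
      · intro hy
        obtain ⟨j, hj, z, rfl⟩ := mem_sup_span_singleton'.1 hy
        exact mem_sup_span_singleton'.2 ⟨_, (hJ' j).1 hj, X i * z, by ring⟩
      · intro hy
        obtain ⟨j, z, hj, rfl⟩ := hJ.exists_eq_add hc hy
        exact mem_sup_span_singleton'.2 ⟨j, (hJ' j).2 hj, z, rfl⟩

theorem KillStable.regSeq_append_X (hJ : KillStable i J) (hX : RegOn J (X i))
    {cs : List (ι → k)} (hcs : ∀ c ∈ cs, c i = 0) (h : RegSeq J (cs.map (linForm k))) :
    RegSeq J (cs.map (linForm k) ++ [X i]) := by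
  induction cs generalizing J with
  | nil => exact ⟨hX, trivial⟩
  | cons c cs ih =>
    have hc := killVar_linForm (hcs c (by simp))
    refine ⟨h.1, ih (hJ.sup hc) ?_ (fun e he => hcs e (by simp [he])) h.2⟩
    intro y hy
    obtain ⟨j, z, hj, rfl⟩ := hJ.exists_eq_add hc hy
    exact mem_sup_span_singleton'.2 ⟨j, hX j hj, z, rfl⟩

end KillVariable

section StanleyReisner

variable {k}

/-- The closed star of `s` in `D`. -/
def SC.star (D : SC n) (s : Finset (Fin n)) : SC n where
  faces := D.faces.filter fun t => t ∪ s ∈ D.faces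
  down_closed := by
    intro t ht u hu
    rw [Finset.mem_filter] at ht ⊢
    exact ⟨D.down_closed _ ht.1 _ hu,
      D.down_closed _ ht.2 _ (Finset.union_subset_union_left hu)⟩

theorem SC.mem_star {D : SC n} {s t : Finset (Fin n)} :
    t ∈ (D.star s).faces ↔ t ∪ s ∈ D.faces := by
  rw [star, Finset.mem_filter, and_iff_right_iff_imp]
  exact fun h => D.down_closed _ h _ Finset.subset_union_left

theorem SC.ext_faces {D E : SC n} (h : ∀ t, t ∈ D.faces ↔ t ∈ E.faces) : D = E := by
  cases D; cases E
  congr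
  exact Finset.ext h

theorem prod_X_eq_monomial (s : Finset (Fin n)) :
    (∏ i ∈ s, X i : MvPolynomial (Fin n) k) = monomial (∑ i ∈ s, Finsupp.single i 1) 1 := by
  rw [monomial_sum_one]
  rfl

theorem sum_single_le_iff {s : Finset (Fin n)} {m : Fin n →₀ ℕ} :
    ∑ i ∈ s, Finsupp.single i 1 ≤ m ↔ s ⊆ m.support := by
  have key : ∀ j, (∑ i ∈ s, Finsupp.single i 1 : Fin n →₀ ℕ) j = if j ∈ s then 1 else 0 := by
    intro j
    rw [Finsupp.finsetSum_apply]
    simp [Finsupp.single_apply]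
  constructor
  · intro h j hj
    have := h j
    rw [key, if_pos hj] at this
    rw [Finsupp.mem_support_iff]
    omega
  · intro h j
    rw [key]
    split_ifs with hj
    · exact Nat.one_le_iff_ne_zero.2 (Finsupp.mem_support_iff.1 (h hj))
    · exact Nat.zero_le _

theorem support_sum_single (s : Finset (Fin n)) :
    (∑ i ∈ s, Finsupp.single i 1 : Fin n →₀ ℕ).support = s := by
  ext j
  rw [Finsupp.mem_support_iff, Finsupp.finsetSum_apply]
  simp [Finsupp.single_apply]

theorem mem_srIdeal {D : SC n} {p : MvPolynomial (Fin n) k} :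
    p ∈ srIdeal k D ↔ ∀ m ∈ p.support, m.support ∉ D.faces := by
  have : srIdeal k D = Ideal.span ((fun e => monomial e 1) ''
      {e | ∃ s : Finset (Fin n), s ∉ D.faces ∧ e = ∑ i ∈ s, Finsupp.single i 1}) := by
    rw [srIdeal]
    congr 1
    ext q
    simp only [prod_X_eq_monomial, Set.mem_ofPred_eq, Set.mem_image]
    constructor
    · rintro ⟨s, hs, rfl⟩
      exact ⟨_, ⟨s, hs, rfl⟩, rfl⟩
    · rintro ⟨_, ⟨s, hs, rfl⟩, rfl⟩
      exact ⟨s, hs, rfl⟩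
  rw [this, mem_ideal_span_monomial_image]
  refine forall₂_congr fun m _ => ?_
  constructor
  · rintro ⟨_, ⟨s, hs, rfl⟩, hle⟩ hm
    exact hs (D.down_closed _ hm _ (sum_single_le_iff.1 hle))
  · intro hm
    exact ⟨_, ⟨_, hm, rfl⟩, sum_single_le_iff.2 subset_rfl⟩

theorem monomial_mul_mem_srIdeal {D : SC n} {e : Fin n →₀ ℕ} {p : MvPolynomial (Fin n) k} :
    monomial e 1 * p ∈ srIdeal k D ↔ p ∈ srIdeal k (D.star e.support) := by
  have key : ∀ m, m ∈ p.support ↔ e + m ∈ (monomial e 1 * p).support := by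
    intro m
    rw [mem_support_iff, mem_support_iff, coeff_monomial_mul, one_mul]
  have hsupp : ∀ m : Fin n →₀ ℕ, (e + m).support = m.support ∪ e.support := by
    intro m
    ext j
    simp only [Finsupp.mem_support_iff, Finset.mem_union, Finsupp.add_apply]
    omega
  rw [mem_srIdeal, mem_srIdeal]
  constructor
  · intro h m hm
    rw [SC.mem_star, ← hsupp]
    exact h _ ((key m).1 hm)
  · intro h m hm
    obtain ⟨m', rfl⟩ : ∃ m', m = e + m' := by
      by_contra hne
      rw [mem_support_iff, coeff_monomial_mul'] at hm
      split_ifs at hm with hle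
      · exact hne ⟨m - e, (add_tsub_cancel_of_le hle).symm⟩
      · exact hm rfl
    have := h m' ((key m').2 hm)
    rwa [SC.mem_star, ← hsupp] at this

theorem X_mul_mem_srIdeal {D : SC n} {i : Fin n} {p : MvPolynomial (Fin n) k} :
    X i * p ∈ srIdeal k D ↔ p ∈ srIdeal k (D.star {i}) := by
  rw [X, monomial_mul_mem_srIdeal, Finsupp.support_single_ne_zero _ one_ne_zero]

theorem linkIdeal_eq (D : SC n) (σ : Finset (Fin n)) :
    linkIdeal k D σ = srIdeal k (D.star σ) := by
  ext p
  rw [linkIdeal, Ideal.mem_colon_span_singleton, mul_comm, xFace, prod_X_eq_monomial,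
    monomial_mul_mem_srIdeal, support_sum_single]

theorem homog_srIdeal (D : SC n) : Homog (srIdeal k D) :=
  homog_span fun p hp => by
    obtain ⟨s, -, rfl⟩ := hp
    exact ⟨_, IsHomogeneous.prod s _ (fun _ => 1) fun i _ => isHomogeneous_X k i⟩

theorem srIdeal_le_irrel {D : SC n} (hD : ∅ ∈ D.faces) : srIdeal k D ≤ irrel k (Fin n) := by
  rw [srIdeal, Ideal.span_le]
  rintro _ ⟨s, hs, rfl⟩
  obtain ⟨i, hi⟩ : s.Nonempty := by
    rw [Finset.nonempty_iff_ne_empty]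
    rintro rfl
    exact hs hD
  exact Ideal.mem_of_dvd _ (Finset.dvd_prod_of_mem _ hi) (Ideal.subset_span ⟨i, rfl⟩)

theorem killStable_srIdeal (D : SC n) (i : Fin n) : KillStable i (srIdeal k D) := by
  suffices srIdeal k D ≤ (srIdeal k D).comap (killVar i) from fun p hp => this hp
  conv_lhs => rw [srIdeal]
  rw [Ideal.span_le]
  rintro _ ⟨s, hs, rfl⟩
  rw [SetLike.mem_coe, Ideal.mem_comap, map_prod]
  by_cases hi : i ∈ s
  · rw [Finset.prod_eq_zero hi (killVar_X_self i)]
    exact zero_mem _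
  · refine Ideal.subset_span ⟨s, hs, Finset.prod_congr rfl fun j hj => ?_⟩
    have : j ≠ i := fun h => hi (h ▸ hj)
    simp [killVar, this]

theorem DepthIn.srIdeal_star_singleton [Infinite k] {D : SC n} {t : ℕ}
    (h : DepthIn (irrel k (Fin n)) t (srIdeal k D)) (i : Fin n) :
    DepthIn (irrel k (Fin n)) t (srIdeal k (D.star {i})) := by
  cases t with
  | zero => trivial
  | succ t =>
    obtain ⟨cs, hl, hcs, hr⟩ := (homog_srIdeal D).exists_linForm_regSeq_free h i
    have h1 := (killStable_srIdeal D i).regSeq_colon (fun y => X_mul_mem_srIdeal.symm) hcs hr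
    have hX : RegOn (srIdeal k (D.star {i})) (X i) := by
      intro y hy
      rw [X_mul_mem_srIdeal] at hy
      have : (D.star {i}).star {i} = D.star {i} := SC.ext_faces fun t => by
        rw [SC.mem_star, SC.mem_star, SC.mem_star, Finset.union_assoc, Finset.union_self]
      rwa [this] at hy
    have h2 := ((killStable_srIdeal _ i).regSeq_append_X hX hcs h1).depthIn
      (m := irrel k (Fin n)) (by
        intro a ha
        rcases List.mem_append.1 ha with ha | ha
        · obtain ⟨c, -, rfl⟩ := List.mem_map.1 ha
          exact linForm_mem_irrel c
        · rw [List.mem_singleton.1 ha]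
          exact Ideal.subset_span ⟨i, rfl⟩)
    simpa [hl] using h2

/-- The depth of the Stanley–Reisner ring does not decrease when passing to the link of a face. -/
theorem DepthIn.linkIdeal [Infinite k] {D : SC n} {t : ℕ}
    (h : DepthIn (irrel k (Fin n)) t (srIdeal k D)) (σ : Finset (Fin n)) :
    DepthIn (irrel k (Fin n)) t (linkIdeal k D σ) := by
  rw [linkIdeal_eq]
  induction σ using Finset.induction_on with
  | empty =>
    have : D.star ∅ = D := SC.ext_faces fun t => by rw [SC.mem_star, Finset.union_empty]
    rwa [this]
  | insert i s _ ih =>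
    have : D.star (insert i s) = (D.star s).star {i} := SC.ext_faces fun t => by
      rw [SC.mem_star, SC.mem_star, SC.mem_star, Finset.union_assoc, Finset.insert_eq]
    rw [this]
    exact ih.srIdeal_star_singleton i

end StanleyReisner

section LinkCM

variable {k}

theorem nontrivial_quotient_of_le_irrel {J : Ideal (MvPolynomial ι k)} (hJ : J ≤ irrel k ι) :
    Nontrivial (MvPolynomial ι k ⧸ J) := by
  refine Ideal.Quotient.nontrivial_iff.2 fun h => ?_
  have h1 : (1 : MvPolynomial ι k) ∈ irrel k ι := hJ (h ▸ Submodule.mem_top)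
  have h2 : irrel k ι ≤ RingHom.ker (aeval (R := k) (0 : ι → k)).toRingHom := by
    rw [irrel, Ideal.span_le]
    rintro _ ⟨i, rfl⟩
    simp
  simpa using h2 h1

theorem sup_ofList_le_irrel {J : Ideal (MvPolynomial ι k)} (hJ : J ≤ irrel k ι)
    (cs : List (ι → k)) : J ⊔ Ideal.ofList (cs.map (linForm k)) ≤ irrel k ι := by
  refine sup_le hJ (Ideal.span_le.2 fun a ha => ?_)
  obtain ⟨c, -, rfl⟩ := List.mem_map.1 ha
  exact linForm_mem_irrel c

theorem length_le_ringKrullDim {J : Ideal (MvPolynomial ι k)} (hJ : J ≤ irrel k ι)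
    {cs : List (ι → k)} (h : RegSeq J (cs.map (linForm k))) :
    (cs.length : WithBot ℕ∞) ≤ ringKrullDim (MvPolynomial ι k ⧸ J) := by
  have := nontrivial_quotient_of_le_irrel (sup_ofList_le_irrel hJ cs)
  have h0 := ringKrullDim_nonneg_of_nontrivial
    (R := MvPolynomial ι k ⧸ J ⊔ Ideal.ofList (cs.map (linForm k)))
  refine le_trans ?_ (ringKrullDim_quotient_sup_ofList_add_length_le h)
  rw [List.length_map]
  simpa using add_le_add_left h0 (cs.length : WithBot ℕ∞)

/-- A linear regular sequence of length at least the Krull dimension witnesses Cohen–Macaulayness. -/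
theorem isCM_of_regSeq {J : Ideal (MvPolynomial ι k)} (hJ : J ≤ irrel k ι)
    {cs : List (ι → k)} (h : RegSeq J (cs.map (linForm k)))
    (hdim : ringKrullDim (MvPolynomial ι k ⧸ J) ≤ cs.length) : isCM k J cs.length := by
  refine ⟨le_antisymm hdim (length_le_ringKrullDim hJ h), (depthGE_iff_exists_regSeq hJ).2
    ⟨_, List.length_map _, fun a ha => ?_, h⟩⟩
  obtain ⟨c, -, rfl⟩ := List.mem_map.1 ha
  exact linForm_mem_irrel c

theorem linkIdeal_le_irrel {D : SC n} {σ : Finset (Fin n)} (hσ : σ ∈ D.faces) :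
    linkIdeal k D σ ≤ irrel k (Fin n) := by
  rw [linkIdeal_eq]
  exact srIdeal_le_irrel (SC.mem_star.2 (by rwa [Finset.empty_union]))

theorem srIdeal_le_linkIdeal (D : SC n) (σ : Finset (Fin n)) :
    srIdeal k D ≤ linkIdeal k D σ := fun _ hp =>
  Submodule.mem_colon.2 fun _ _ => Ideal.mul_mem_right _ _ hp

theorem exists_regSeq_srIdeal_linkIdeal [Infinite k] {D : SC n} {σ : Finset (Fin n)}
    (hσ : σ ∈ D.faces) {d : ℕ} (h : isCM k (srIdeal k D) d) :
    ∃ cs : List (Fin n → k), cs.length = d ∧ RegSeq (srIdeal k D) (cs.map (linForm k)) ∧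
      RegSeq (linkIdeal k D σ) (cs.map (linForm k)) := by
  obtain ⟨l, rfl, hl, hr⟩ := (depthGE_iff_exists_regSeq
    (srIdeal_le_irrel (D.down_closed _ hσ _ (Finset.empty_subset _)))).1 h.2
  exact exists_linForm_regSeq (hr.depthIn hl) ((hr.depthIn hl).linkIdeal σ)

theorem isCM_linkIdeal [Infinite k] {D : SC n} {σ : Finset (Fin n)}
    (hσ : σ ∈ D.faces) {d : ℕ} (h : isCM k (srIdeal k D) d) : isCM k (linkIdeal k D σ) d := by
  obtain ⟨cs, rfl, -, h2⟩ := exists_regSeq_srIdeal_linkIdeal hσ h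
  refine isCM_of_regSeq (linkIdeal_le_irrel hσ) h2 (le_trans ?_ h.1.le)
  exact ringKrullDim_le_of_surjective (Ideal.Quotient.factor (srIdeal_le_linkIdeal D σ))
    (Ideal.Quotient.factor_surjective _)

end LinkCM

section AdjoinT

variable {k}

/-- The ideal `(J₁, T ^ (q + 1), T J₂)` of `R[T]`. -/
def truncIdeal (q : ℕ) (J₁ J₂ : Ideal (MvPolynomial (Fin n) k)) :
    Ideal (MvPolynomial (Fin (n + 1)) k) :=
  extI k J₁ ⊔ Ideal.span {Tv k n ^ (q + 1)} ⊔ TmulI k J₂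

/-- `R[T]` as a univariate polynomial ring over `R`. -/
def lastEquiv (k : Type) [Field k] (n : ℕ) :
    MvPolynomial (Fin (n + 1)) k ≃ₐ[k] Polynomial (MvPolynomial (Fin n) k) :=
  (renameEquiv k finSuccEquivLast).trans (optionEquivLeft k (Fin n))

theorem lastEquiv_Tv : lastEquiv k n (Tv k n) = Polynomial.X := by
  simp [lastEquiv, Tv]

theorem lastEquiv_toT (p : MvPolynomial (Fin n) k) : lastEquiv k n (toT k p) = Polynomial.C p := by
  have : ((lastEquiv k n).toAlgHom.comp (toT k)) =
      (Polynomial.CAlgHom (R := MvPolynomial (Fin n) k)).restrictScalars k := by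
    ext i
    simp [lastEquiv, toT]
  exact DFunLike.congr_fun this p

theorem lastEquiv_toT_mul (a : MvPolynomial (Fin n) k) (p : MvPolynomial (Fin (n + 1)) k) (j : ℕ) :
    (lastEquiv k n (toT k a * p)).coeff j = a * (lastEquiv k n p).coeff j := by
  rw [map_mul, lastEquiv_toT, Polynomial.coeff_C_mul]

theorem eq_sum_lastEquiv_coeff (p : MvPolynomial (Fin (n + 1)) k) :
    p = ∑ j ∈ (lastEquiv k n p).support, toT k ((lastEquiv k n p).coeff j) * Tv k n ^ j := by
  apply (lastEquiv k n).injective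
  simp only [map_sum, map_mul, map_pow, lastEquiv_toT, lastEquiv_Tv]
  exact (lastEquiv k n p).as_sum_support_C_mul_X_pow

theorem mem_truncIdeal {q : ℕ} {J₁ J₂ : Ideal (MvPolynomial (Fin n) k)} (hJ : J₁ ≤ J₂)
    {p : MvPolynomial (Fin (n + 1)) k} :
    p ∈ truncIdeal q J₁ J₂ ↔ (lastEquiv k n p).coeff 0 ∈ J₁ ∧
      ∀ j ≤ q, (lastEquiv k n p).coeff j ∈ J₂ := by
  constructor
  · intro hp
    let K : Ideal (MvPolynomial (Fin (n + 1)) k) :=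
      { carrier := {p | (lastEquiv k n p).coeff 0 ∈ J₁ ∧ ∀ j ≤ q, (lastEquiv k n p).coeff j ∈ J₂}
        add_mem' := by
          intro a b ha hb
          refine ⟨?_, fun j hj => ?_⟩
          · simpa using add_mem ha.1 hb.1
          · simpa using add_mem (ha.2 j hj) (hb.2 j hj)
        zero_mem' := by simp
        smul_mem' := by
          intro c x hx
          refine ⟨?_, fun j hj => ?_⟩
          · simpa [Polynomial.mul_coeff_zero] using Ideal.mul_mem_left _ _ hx.1
          · rw [smul_eq_mul, map_mul, Polynomial.coeff_mul]
            refine Ideal.sum_mem _ fun ij hij => Ideal.mul_mem_left _ _ (hx.2 _ ?_)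
            have := Finset.HasAntidiagonal.mem_antidiagonal.1 hij
            omega }
    have hle : truncIdeal q J₁ J₂ ≤ K := by
      refine sup_le (sup_le (Ideal.map_le_iff_le_comap.2 fun a ha => ?_) ?_) ?_
      · refine ⟨?_, fun j _ => ?_⟩
        · simpa [lastEquiv_toT] using ha
        · rw [lastEquiv_toT, Polynomial.coeff_C]
          split_ifs
          exacts [hJ ha, zero_mem _]
      · rw [Ideal.span_singleton_le_iff_mem]
        refine ⟨?_, fun j hj => ?_⟩
        · simp [lastEquiv_Tv]
        · rw [map_pow, lastEquiv_Tv, Polynomial.coeff_X_pow, if_neg (by omega)]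
          exact zero_mem _
      · refine Ideal.span_le.2 ?_
        rintro _ ⟨a, ha, rfl⟩
        refine ⟨?_, fun j _ => ?_⟩
        · simp [lastEquiv_Tv]
        · change (lastEquiv k n (Tv k n * toT k a)).coeff j ∈ J₂
          rw [mul_comm, lastEquiv_toT_mul]
          exact Ideal.mul_mem_right _ _ ha
    exact hle hp
  · rintro ⟨h0, h1⟩
    rw [eq_sum_lastEquiv_coeff p]
    refine Ideal.sum_mem _ fun j _ => ?_
    by_cases hj0 : j = 0
    · subst hj0
      exact Ideal.mem_sup_left (Ideal.mem_sup_left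
        (Ideal.mul_mem_right _ _ (Ideal.mem_map_of_mem _ h0)))
    by_cases hj : j ≤ q
    · refine Ideal.mem_sup_right ?_
      have : toT k ((lastEquiv k n p).coeff j) * Tv k n ^ j =
          Tv k n ^ (j - 1) * (Tv k n * toT k ((lastEquiv k n p).coeff j)) := by
        obtain ⟨i, rfl⟩ := Nat.exists_eq_succ_of_ne_zero hj0
        rw [Nat.succ_sub_one, pow_succ]
        ring
      rw [this]
      exact Ideal.mul_mem_left _ _ (Ideal.subset_span ⟨_, h1 j hj, rfl⟩)
    · refine Ideal.mem_sup_left (Ideal.mem_sup_right (Ideal.mul_mem_left _ _ ?_))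
      exact Ideal.mem_span_singleton.2 (pow_dvd_pow _ (by omega))

theorem truncIdeal_sup_span (q : ℕ) (J₁ J₂ : Ideal (MvPolynomial (Fin n) k))
    (a : MvPolynomial (Fin n) k) :
    truncIdeal q J₁ J₂ ⊔ Ideal.span {toT k a} =
      truncIdeal q (J₁ ⊔ Ideal.span {a}) (J₂ ⊔ Ideal.span {a}) := by
  have hext : extI k (J₁ ⊔ Ideal.span {a}) = extI k J₁ ⊔ Ideal.span {toT k a} := by
    rw [extI, extI, Ideal.map_sup, Ideal.map_span, Set.image_singleton]
  have hmono : TmulI k J₂ ≤ TmulI k (J₂ ⊔ Ideal.span {a}) :=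
    Ideal.span_mono (Set.image_mono fun x hx => Ideal.mem_sup_left hx)
  apply le_antisymm
  · rw [truncIdeal, truncIdeal, hext]
    refine sup_le (sup_le (sup_le ?_ ?_) ?_) ?_
    · exact le_sup_of_le_left (le_sup_of_le_left le_sup_left)
    · exact le_sup_of_le_left le_sup_right
    · exact le_sup_of_le_right hmono
    · exact le_sup_of_le_left (le_sup_of_le_left le_sup_right)
  · rw [truncIdeal, truncIdeal, hext]
    refine sup_le (sup_le (sup_le ?_ ?_) ?_) (Ideal.span_le.2 ?_)
    · exact le_sup_of_le_left (le_sup_of_le_left le_sup_left)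
    · exact le_sup_right
    · exact le_sup_of_le_left (le_sup_of_le_left le_sup_right)
    · rintro _ ⟨x, hx, rfl⟩
      obtain ⟨j, hj, y, rfl⟩ := mem_sup_span_singleton'.1 hx
      simp only [map_add, map_mul, mul_add]
      refine add_mem (Ideal.mem_sup_left (Ideal.mem_sup_right (Ideal.subset_span ⟨j, hj, rfl⟩)))
        (Ideal.mem_sup_right ?_)
      exact Ideal.mem_span_singleton.2 ⟨Tv k n * toT k y, by ring⟩

theorem RegSeq.truncIdeal (q : ℕ) {J₁ J₂ : Ideal (MvPolynomial (Fin n) k)} (hJ : J₁ ≤ J₂)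
    {l : List (MvPolynomial (Fin n) k)} (h₁ : RegSeq J₁ l) (h₂ : RegSeq J₂ l) :
    RegSeq (truncIdeal q J₁ J₂) (l.map (toT k)) := by
  induction l generalizing J₁ J₂ with
  | nil => trivial
  | cons a l ih =>
    refine ⟨fun x hx => ?_, ?_⟩
    · rw [mem_truncIdeal hJ] at hx ⊢
      simp only [lastEquiv_toT_mul] at hx
      exact ⟨h₁.1 _ hx.1, fun j hj => h₂.1 _ (hx.2 j hj)⟩
    · rw [truncIdeal_sup_span]
      exact ih (sup_le_sup_right hJ _) h₁.2 h₂.2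

theorem toT_linForm (c : Fin n → k) : toT k (linForm k c) = linForm k (Fin.snoc c 0) := by
  simp [linForm, toT, Fin.sum_univ_castSucc]

theorem truncIdeal_le_irrel (q : ℕ) {J₁ J₂ : Ideal (MvPolynomial (Fin n) k)}
    (hJ : J₁ ≤ irrel k (Fin n)) : truncIdeal q J₁ J₂ ≤ irrel k (Fin (n + 1)) := by
  have hT : Tv k n ∈ irrel k (Fin (n + 1)) := Ideal.subset_span ⟨_, rfl⟩
  refine sup_le (sup_le (Ideal.map_le_iff_le_comap.2 (hJ.trans ?_)) ?_) (Ideal.span_le.2 ?_)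
  · rw [irrel, Ideal.span_le]
    rintro _ ⟨i, rfl⟩
    rw [SetLike.mem_coe, Ideal.mem_comap, toT, rename_X]
    exact Ideal.subset_span ⟨_, rfl⟩
  · rw [Ideal.span_singleton_le_iff_mem]
    exact Ideal.pow_mem_of_mem _ hT _ (Nat.succ_pos _)
  · rintro _ ⟨x, -, rfl⟩
    exact Ideal.mul_mem_right _ _ hT

theorem isHomogeneous_toT {p : MvPolynomial (Fin n) k} {m : ℕ} (hp : p.IsHomogeneous m) :
    (toT k p).IsHomogeneous m := hp.rename_isHomogeneous

theorem Homog.eq_span {ι : Type} [Fintype ι] {J : Ideal (MvPolynomial ι k)} (hJ : Homog J) :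
    J = Ideal.span {p | p ∈ J ∧ ∃ m, p.IsHomogeneous m} := by
  refine le_antisymm (fun p hp => ?_) (Ideal.span_le.2 fun p hp => hp.1)
  rw [← sum_homogeneousComponent p]
  exact Ideal.sum_mem _ fun m _ =>
    Ideal.subset_span ⟨hJ p hp m, m, homogeneousComponent_isHomogeneous _ _⟩

theorem Homog.truncIdeal (q : ℕ) {J₁ J₂ : Ideal (MvPolynomial (Fin n) k)} (h₁ : Homog J₁)
    (h₂ : Homog J₂) : Homog (truncIdeal q J₁ J₂) := by
  have hT : (Tv k n).IsHomogeneous 1 := isHomogeneous_X _ _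
  refine Homog.sup (Homog.sup ?_ ?_) ?_
  · rw [h₁.eq_span, extI, Ideal.map_span]
    refine homog_span ?_
    rintro _ ⟨p, ⟨-, m, hm⟩, rfl⟩
    exact ⟨m, isHomogeneous_toT hm⟩
  · refine homog_span fun p hp => ⟨1 * (q + 1), ?_⟩
    rw [Set.mem_singleton_iff.1 hp]
    exact hT.pow _
  · have : TmulI k J₂ = Ideal.span ((fun f => Tv k n * toT k f) ''
        {p | p ∈ J₂ ∧ ∃ m, p.IsHomogeneous m}) := by
      refine le_antisymm (Ideal.span_le.2 ?_) (Ideal.span_mono (Set.image_mono fun p hp => hp.1))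
      rintro _ ⟨p, hp, rfl⟩
      simp only
      rw [← sum_homogeneousComponent p, map_sum, Finset.mul_sum]
      exact Ideal.sum_mem _ fun m _ =>
        Ideal.subset_span ⟨_, ⟨h₂ p hp m, m, homogeneousComponent_isHomogeneous _ _⟩, rfl⟩
    rw [this]
    refine homog_span ?_
    rintro _ ⟨p, ⟨-, m, hm⟩, rfl⟩
    exact ⟨_, hT.mul (isHomogeneous_toT hm)⟩

end AdjoinT

section TruncCM

variable {k}

theorem ringKrullDim_truncIdeal_le (q : ℕ) (J₁ J₂ : Ideal (MvPolynomial (Fin n) k)) :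
    ringKrullDim (MvPolynomial (Fin (n + 1)) k ⧸ truncIdeal q J₁ J₂) ≤
      ringKrullDim (MvPolynomial (Fin n) k ⧸ J₁) := by
  set K := truncIdeal q J₁ J₂ ⊔ Ideal.span {Tv k n} with hK
  have hTK : Tv k n ∈ K := Ideal.mem_sup_right (Ideal.mem_span_singleton_self _)
  have hz : PrimeSpectrum.zeroLocus (truncIdeal q J₁ J₂ : Set (MvPolynomial (Fin (n + 1)) k)) =
      PrimeSpectrum.zeroLocus (K : Set (MvPolynomial (Fin (n + 1)) k)) := by
    ext p
    rw [PrimeSpectrum.mem_zeroLocus, PrimeSpectrum.mem_zeroLocus, SetLike.coe_subset_coe,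
      SetLike.coe_subset_coe, hK, sup_le_iff, iff_self_and, Ideal.span_singleton_le_iff_mem]
    intro h
    refine p.2.mem_of_pow_mem (q + 1) (h ?_)
    exact Ideal.mem_sup_left (Ideal.mem_sup_right (Ideal.mem_span_singleton_self _))
  rw [ringKrullDim_quotient, hz, ← ringKrullDim_quotient]
  have hle : J₁ ≤ K.comap (toT k) := Ideal.map_le_iff_le_comap.1
    (le_sup_of_le_left (le_sup_of_le_left le_sup_left))
  refine ringKrullDim_le_of_surjective (Ideal.quotientMap K (toT k).toRingHom hle) fun y => ?_
  obtain ⟨y, rfl⟩ := Ideal.Quotient.mk_surjective y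
  induction y using MvPolynomial.induction_on with
  | C a => exact ⟨Ideal.Quotient.mk _ (C a), by simp [toT]⟩
  | add p q hp hq =>
    obtain ⟨a, ha⟩ := hp
    obtain ⟨b, hb⟩ := hq
    exact ⟨a + b, by rw [map_add, ha, hb, map_add]⟩
  | mul_X p i hp =>
    obtain ⟨a, ha⟩ := hp
    induction i using Fin.lastCases with
    | last =>
      refine ⟨0, ?_⟩
      rw [map_zero, eq_comm, Ideal.Quotient.eq_zero_iff_mem]
      exact Ideal.mul_mem_left _ _ hTK
    | cast i => exact ⟨a * Ideal.Quotient.mk _ (X i), by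
        rw [map_mul, ha, map_mul]; simp [toT]⟩

/-- There is a regular sequence of linear forms of `R` on `R[T] ⧸ I_C`. -/
theorem exists_regSeq_IC [Infinite k] {D : SC n} {σ : Finset (Fin n)} (hσ : σ ∈ D.faces) (q : ℕ)
    {d : ℕ} (h : isCM k (srIdeal k D) d) :
    ∃ cs : List (Fin n → k), cs.length = d ∧
      RegSeq (IC k D σ q) ((cs.map fun c => Fin.snoc (α := fun _ => k) c 0).map (linForm k)) := by
  obtain ⟨cs, hcs, h1, h2⟩ := exists_regSeq_srIdeal_linkIdeal hσ h
  refine ⟨cs, hcs, ?_⟩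
  have := h1.truncIdeal q (srIdeal_le_linkIdeal D σ) h2
  rw [List.map_map] at this ⊢
  have he : toT k ∘ linForm k = linForm k ∘ fun c : Fin n → k => Fin.snoc (α := fun _ => k) c 0 :=
    funext toT_linForm
  rwa [he] at this

theorem IC_le_irrel {D : SC n} {σ : Finset (Fin n)} (hσ : σ ∈ D.faces) (q : ℕ) :
    IC k D σ q ≤ irrel k (Fin (n + 1)) :=
  truncIdeal_le_irrel q (srIdeal_le_irrel (D.down_closed _ hσ _ (Finset.empty_subset _)))

theorem homog_IC (D : SC n) (σ : Finset (Fin n)) (q : ℕ) : Homog (IC k D σ q) :=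
  (homog_srIdeal D).truncIdeal q (by rw [linkIdeal_eq]; exact homog_srIdeal _)

theorem isCM_IC [Infinite k] {D : SC n} {σ : Finset (Fin n)} (hσ : σ ∈ D.faces) (q : ℕ)
    {d : ℕ} (h : isCM k (srIdeal k D) d) : isCM k (IC k D σ q) d := by
  obtain ⟨cs, rfl, h1⟩ := exists_regSeq_IC hσ q h
  have hl : (cs.map fun c => Fin.snoc (α := fun _ => k) c 0).length = cs.length :=
    List.length_map _
  have := isCM_of_regSeq (IC_le_irrel hσ q) h1 (by
    rw [hl]
    exact (ringKrullDim_truncIdeal_le q _ _).trans h.1.le)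
  rwa [hl] at this

end TruncCM

section Hilbert

variable {k}

instance finite_homogeneousSubmodule (m : ℕ) : Module.Finite k (homogeneousSubmodule ι k m) :=
  Module.Finite.iff_fg.2 (homogeneousSubmodule_fg _ _ m)

instance finite_qComp (J : Ideal (MvPolynomial ι k)) (m : ℕ) : Module.Finite k (qComp k J m) :=
  Module.Finite.map _ _

theorem mem_qComp {J : Ideal (MvPolynomial ι k)} {m : ℕ} {x : MvPolynomial ι k ⧸ J} :
    x ∈ qComp k J m ↔ ∃ p : MvPolynomial ι k, p.IsHomogeneous m ∧ Ideal.Quotient.mk J p = x :=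
  Iff.rfl

/-- Multiplication by a linear form between graded components. -/
def mulForm (J : Ideal (MvPolynomial ι k)) (c : ι → k) (m : ℕ) :
    qComp k J m →ₗ[k] qComp k J (m + 1) :=
  (LinearMap.mulLeft k (Ideal.Quotient.mk J (linForm k c))).restrict (by
    rintro x hx
    obtain ⟨p, hp, rfl⟩ := mem_qComp.1 hx
    refine mem_qComp.2 ⟨linForm k c * p, ?_, map_mul _ _ _⟩
    rw [add_comm]
    exact (isHomogeneous_linForm c).mul hp)

/-- The projection between graded components of quotients. -/
def projComp {J K : Ideal (MvPolynomial ι k)} (h : J ≤ K) (m : ℕ) :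
    qComp k J m →ₗ[k] qComp k K m :=
  (Ideal.Quotient.factorₐ k h).toLinearMap.restrict (by
    rintro x hx
    obtain ⟨p, hp, rfl⟩ := mem_qComp.1 hx
    exact mem_qComp.2 ⟨p, hp, rfl⟩)

theorem projComp_surjective {J K : Ideal (MvPolynomial ι k)} (h : J ≤ K) (m : ℕ) :
    Function.Surjective (projComp h m) := by
  rintro ⟨x, hx⟩
  obtain ⟨p, hp, rfl⟩ := mem_qComp.1 hx
  exact ⟨⟨_, mem_qComp.2 ⟨p, hp, rfl⟩⟩, rfl⟩

theorem Homog.ker_projComp {J : Ideal (MvPolynomial ι k)} (hJ : Homog J) (c : ι → k) (m : ℕ) :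
    LinearMap.ker (projComp (le_sup_left : J ≤ J ⊔ Ideal.span {linForm k c}) (m + 1)) =
      LinearMap.range (mulForm J c m) := by
  apply le_antisymm
  · rintro ⟨x, hx⟩ h
    obtain ⟨p, hp, rfl⟩ := mem_qComp.1 hx
    have h' : Ideal.Quotient.mk (J ⊔ Ideal.span {linForm k c}) p = 0 := congrArg Subtype.val h
    rw [Ideal.Quotient.eq_zero_iff_mem] at h'
    obtain ⟨j, hj, y, rfl⟩ := mem_sup_span_singleton'.1 h'
    refine ⟨⟨Ideal.Quotient.mk J (homogeneousComponent m y),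
      mem_qComp.2 ⟨_, homogeneousComponent_isHomogeneous _ _, rfl⟩⟩, Subtype.ext ?_⟩
    change Ideal.Quotient.mk J (linForm k c) * Ideal.Quotient.mk J (homogeneousComponent m y) =
      Ideal.Quotient.mk J (j + linForm k c * y)
    have hp' := homogeneousComponent_of_mem (m := m + 1) hp
    rw [if_pos rfl, map_add, homogeneousComponent_mul_of_isHomogeneous (isHomogeneous_linForm c)]
      at hp'
    rw [← hp', map_add, Ideal.Quotient.eq_zero_iff_mem.2 (hJ j hj (m + 1)), zero_add, map_mul]
  · rintro _ ⟨⟨x, hx⟩, rfl⟩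
    obtain ⟨p, hp, rfl⟩ := mem_qComp.1 hx
    refine LinearMap.mem_ker.2 (Subtype.ext ?_)
    change Ideal.Quotient.mk (J ⊔ Ideal.span {linForm k c}) (linForm k c * p) = 0
    rw [Ideal.Quotient.eq_zero_iff_mem]
    exact Ideal.mem_sup_right (Ideal.mul_mem_right _ _ (Ideal.mem_span_singleton_self _))

theorem Homog.HFq_sup_add_finrank_range {J : Ideal (MvPolynomial ι k)} (hJ : Homog J) (c : ι → k)
    (m : ℕ) : HFq k (J ⊔ Ideal.span {linForm k c}) (m + 1) +
      Module.finrank k (LinearMap.range (mulForm J c m)) = HFq k J (m + 1) := by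
  have := LinearMap.finrank_range_add_finrank_ker
    (projComp (le_sup_left : J ≤ J ⊔ Ideal.span {linForm k c}) (m + 1))
  rwa [LinearMap.range_eq_top.2 (projComp_surjective _ _), finrank_top, hJ.ker_projComp] at this

theorem HFq_eq_range_add_ker (J : Ideal (MvPolynomial ι k)) (c : ι → k) (m : ℕ) :
    Module.finrank k (LinearMap.range (mulForm J c m)) +
      Module.finrank k (LinearMap.ker (mulForm J c m)) = HFq k J m :=
  LinearMap.finrank_range_add_finrank_ker _

/-- The Hilbert function of a hyperplane section. -/
theorem Homog.HFq_sup_add {J : Ideal (MvPolynomial ι k)} (hJ : Homog J) (c : ι → k)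
    (m : ℕ) : HFq k (J ⊔ Ideal.span {linForm k c}) (m + 1) + HFq k J m =
      HFq k J (m + 1) + Module.finrank k (LinearMap.ker (mulForm J c m)) := by
  have := hJ.HFq_sup_add_finrank_range c m
  have := HFq_eq_range_add_ker J c m
  omega

theorem ker_mulForm_eq_bot_iff {J : Ideal (MvPolynomial ι k)} {c : ι → k} {m : ℕ} :
    LinearMap.ker (mulForm J c m) = ⊥ ↔
      ∀ x ∈ qComp k J m, Ideal.Quotient.mk J (linForm k c) * x = 0 → x = 0 := by
  rw [LinearMap.ker_eq_bot']
  constructor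
  · intro h x hx h0
    exact congrArg Subtype.val (h ⟨x, hx⟩ (Subtype.ext h0))
  · rintro h ⟨x, hx⟩ h0
    exact Subtype.ext (h x hx (congrArg Subtype.val h0))

theorem range_mulForm_eq_top_iff {J : Ideal (MvPolynomial ι k)} {c : ι → k} {m : ℕ} :
    LinearMap.range (mulForm J c m) = ⊤ ↔
      ∀ y ∈ qComp k J (m + 1), ∃ x ∈ qComp k J m, Ideal.Quotient.mk J (linForm k c) * x = y := by
  rw [LinearMap.range_eq_top]
  constructor
  · intro h y hy
    obtain ⟨⟨x, hx⟩, h⟩ := h ⟨y, hy⟩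
    exact ⟨x, hx, congrArg Subtype.val h⟩
  · rintro h ⟨y, hy⟩
    obtain ⟨x, hx, h⟩ := h y hy
    exact ⟨⟨x, hx⟩, Subtype.ext h⟩

/-- Maximal rank in terms of the Hilbert function of the hyperplane section. -/
theorem Homog.mulMaxRank_iff {J : Ideal (MvPolynomial ι k)} (hJ : Homog J) (c : ι → k) (m : ℕ) :
    mulMaxRank k J (Ideal.Quotient.mk J (linForm k c)) m ↔
      HFq k (J ⊔ Ideal.span {linForm k c}) (m + 1) ≤ HFq k J (m + 1) - HFq k J m := by
  rw [mulMaxRank, ← ker_mulForm_eq_bot_iff, ← range_mulForm_eq_top_iff,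
    ← Submodule.finrank_eq_zero]
  have h1 := hJ.HFq_sup_add_finrank_range c m
  have h2 := HFq_eq_range_add_ker J c m
  have h3 : LinearMap.range (mulForm J c m) = ⊤ ↔
      Module.finrank k (LinearMap.range (mulForm J c m)) = HFq k J (m + 1) := by
    constructor
    · intro h
      rw [h, finrank_top, HFq]
    · exact Submodule.eq_top_of_finrank_eq
  rw [h3]
  omega

theorem Homog.HFq_sup_zero {J : Ideal (MvPolynomial ι k)} (hJ : Homog J) (c : ι → k) :
    HFq k (J ⊔ Ideal.span {linForm k c}) 0 = HFq k J 0 := by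
  refine (LinearEquiv.finrank_eq (LinearEquiv.ofBijective
    (projComp (le_sup_left : J ≤ J ⊔ Ideal.span {linForm k c}) 0)
    ⟨?_, projComp_surjective _ _⟩)).symm
  rw [← LinearMap.ker_eq_bot, LinearMap.ker_eq_bot']
  rintro ⟨x, hx⟩ h
  obtain ⟨p, hp, rfl⟩ := mem_qComp.1 hx
  have h' : Ideal.Quotient.mk (J ⊔ Ideal.span {linForm k c}) p = 0 := congrArg Subtype.val h
  rw [Ideal.Quotient.eq_zero_iff_mem] at h'
  obtain ⟨j, hj, y, rfl⟩ := mem_sup_span_singleton'.1 h'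
  refine Subtype.ext (Ideal.Quotient.eq_zero_iff_mem.2 ?_)
  have hp' := homogeneousComponent_of_mem (m := 0) hp
  rw [if_pos rfl, map_add, homogeneousComponent_mul_eq_zero (isHomogeneous_linForm c) _ zero_lt_one,
    add_zero] at hp'
  rw [← hp']
  exact hJ j hj 0

theorem RegOn.ker_mulForm {J : Ideal (MvPolynomial ι k)} {c : ι → k} (h : RegOn J (linForm k c))
    (m : ℕ) : LinearMap.ker (mulForm J c m) = ⊥ := by
  rw [ker_mulForm_eq_bot_iff]
  rintro x hx h0
  obtain ⟨p, -, rfl⟩ := mem_qComp.1 hx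
  rw [← map_mul, Ideal.Quotient.eq_zero_iff_mem] at h0
  exact Ideal.Quotient.eq_zero_iff_mem.2 (h p h0)

end Hilbert

section HilbertSeries

variable {k}

/-- The Hilbert series of `k[X] ⧸ J`. -/
def hilbSeries (J : Ideal (MvPolynomial ι k)) : PowerSeries ℤ := PowerSeries.mk fun m => HFq k J m

/-- A power series whose first nonzero coefficient (if any) is positive. -/
def LexNonneg (f : PowerSeries ℤ) : Prop :=
  ∀ m, (∀ j < m, PowerSeries.coeff j f = 0) → 0 ≤ PowerSeries.coeff m f

theorem LexNonneg.add {f g : PowerSeries ℤ} (hf : LexNonneg f) (hg : LexNonneg g) :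
    LexNonneg (f + g) := by
  intro m hm
  have h : ∀ j < m, PowerSeries.coeff j f = 0 ∧ PowerSeries.coeff j g = 0 := by
    intro j
    induction j using Nat.strong_induction_on with
    | _ j ih =>
      intro hj
      have h1 := hf j fun i hi => (ih i hi (hi.trans hj)).1
      have h2 := hg j fun i hi => (ih i hi (hi.trans hj)).2
      have h3 := hm j hj
      rw [map_add] at h3
      constructor <;> linarith
  rw [map_add]
  exact add_nonneg (hf m fun j hj => (h j hj).1) (hg m fun j hj => (h j hj).2)

theorem coeff_one_sub_X_mul_zero (f : PowerSeries ℤ) :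
    PowerSeries.coeff 0 ((1 - PowerSeries.X) * f) = PowerSeries.coeff 0 f := by
  rw [sub_mul, one_mul, map_sub, PowerSeries.coeff_zero_X_mul, sub_zero]

theorem coeff_one_sub_X_mul_succ (f : PowerSeries ℤ) (m : ℕ) :
    PowerSeries.coeff (m + 1) ((1 - PowerSeries.X) * f) =
      PowerSeries.coeff (m + 1) f - PowerSeries.coeff m f := by
  rw [sub_mul, one_mul, map_sub, PowerSeries.coeff_succ_X_mul]

theorem LexNonneg.one_sub_X_mul {f : PowerSeries ℤ} (hf : LexNonneg f) :
    LexNonneg ((1 - PowerSeries.X) * f) := by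
  intro m hm
  have h : ∀ j < m, PowerSeries.coeff j f = 0 := by
    intro j
    induction j with
    | zero => intro hj; rw [← coeff_one_sub_X_mul_zero]; exact hm 0 hj
    | succ j ih =>
      intro hj
      have h1 := hm _ hj
      rw [coeff_one_sub_X_mul_succ, ih (by omega), sub_zero] at h1
      exact h1
  have h0 := hf m h
  cases m with
  | zero => rwa [coeff_one_sub_X_mul_zero]
  | succ m => rwa [coeff_one_sub_X_mul_succ, h m (Nat.lt_succ_self m), sub_zero]

theorem Homog.hilbSeries_sup {J : Ideal (MvPolynomial ι k)} (hJ : Homog J) (c : ι → k) :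
    hilbSeries (J ⊔ Ideal.span {linForm k c}) = (1 - PowerSeries.X) * hilbSeries J +
      PowerSeries.X * PowerSeries.mk fun m =>
        (Module.finrank k (LinearMap.ker (mulForm J c m)) : ℤ) := by
  ext m
  cases m with
  | zero =>
    rw [map_add, coeff_one_sub_X_mul_zero, PowerSeries.coeff_zero_X_mul, hilbSeries, hilbSeries,
      PowerSeries.coeff_mk, PowerSeries.coeff_mk, hJ.HFq_sup_zero, add_zero]
  | succ m =>
    rw [map_add, coeff_one_sub_X_mul_succ, PowerSeries.coeff_succ_X_mul, hilbSeries, hilbSeries,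
      PowerSeries.coeff_mk, PowerSeries.coeff_mk, PowerSeries.coeff_mk, PowerSeries.coeff_mk]
    have := hJ.HFq_sup_add c m
    push_cast [← @Nat.cast_inj ℤ] at this
    linarith

theorem ofList_cons_sup (J : Ideal (MvPolynomial ι k)) (c : ι → k) (cs : List (ι → k)) :
    J ⊔ Ideal.ofList ((c :: cs).map (linForm k)) =
      J ⊔ Ideal.span {linForm k c} ⊔ Ideal.ofList (cs.map (linForm k)) := by
  rw [List.map_cons, Ideal.ofList_cons, sup_assoc]

theorem Homog.lexNonneg_hilbSeries_sub {J : Ideal (MvPolynomial ι k)} (hJ : Homog J)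
    (cs : List (ι → k)) : LexNonneg (hilbSeries (J ⊔ Ideal.ofList (cs.map (linForm k))) -
      (1 - PowerSeries.X) ^ cs.length * hilbSeries J) := by
  induction cs generalizing J with
  | nil => intro m _; simp
  | cons c cs ih =>
    rw [ofList_cons_sup]
    have h1 := ih (hJ.sup (homog_span_linForm c))
    have h2 : ∀ i : ℕ, LexNonneg ((1 - PowerSeries.X) ^ i * (PowerSeries.X * PowerSeries.mk fun m =>
        (Module.finrank k (LinearMap.ker (mulForm J c m)) : ℤ))) := by
      intro i
      induction i with
      | zero =>
        intro m _
        cases m with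
        | zero => simp
        | succ m => simp [PowerSeries.coeff_succ_X_mul]
      | succ i ih =>
        rw [pow_succ', mul_assoc]
        exact ih.one_sub_X_mul
    have h3 := h1.add (h2 cs.length)
    rw [hJ.hilbSeries_sup] at h3
    convert h3 using 1
    rw [List.length_cons]
    ring

theorem Homog.hilbSeries_of_regSeq {J : Ideal (MvPolynomial ι k)} (hJ : Homog J)
    {cs : List (ι → k)} (h : RegSeq J (cs.map (linForm k))) :
    hilbSeries (J ⊔ Ideal.ofList (cs.map (linForm k))) =
      (1 - PowerSeries.X) ^ cs.length * hilbSeries J := by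
  induction cs generalizing J with
  | nil => simp
  | cons c cs ih =>
    rw [ofList_cons_sup, ih (hJ.sup (homog_span_linForm c)) h.2, hJ.hilbSeries_sup]
    have : (PowerSeries.mk fun m =>
        (Module.finrank k (LinearMap.ker (mulForm J c m)) : ℤ)) = 0 := by
      ext m
      rw [PowerSeries.coeff_mk, RegOn.ker_mulForm h.1, finrank_bot]
      simp
    rw [this, List.length_cons]
    ring

/-- Regular sequences of linear forms give the smallest Hilbert function. -/
theorem Homog.HFq_eq_of_le {J : Ideal (MvPolynomial ι k)} (hJ : Homog J)
    {cs ds : List (ι → k)} (h : RegSeq J (cs.map (linForm k))) (hlen : ds.length = cs.length)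
    (hle : ∀ m, HFq k (J ⊔ Ideal.ofList (ds.map (linForm k))) m ≤
      HFq k (J ⊔ Ideal.ofList (cs.map (linForm k))) m) (m : ℕ) :
    HFq k (J ⊔ Ideal.ofList (ds.map (linForm k))) m =
      HFq k (J ⊔ Ideal.ofList (cs.map (linForm k))) m := by
  have h1 := hJ.lexNonneg_hilbSeries_sub ds
  rw [hlen, ← hJ.hilbSeries_of_regSeq h] at h1
  induction m using Nat.strong_induction_on with
  | _ m ih =>
    refine le_antisymm (hle m) ?_
    have h2 := h1 m fun j hj => by
      simp [hilbSeries, ih j hj]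
    simpa [hilbSeries] using h2

end HilbertSeries

section Vanishing

variable {k}

theorem mem_irrel_pow {m : ℕ} {p : MvPolynomial ι k} :
    p ∈ irrel k ι ^ m ↔ ∀ x ∈ p.support, m ≤ x.degree := mem_pow_idealOfVars_iff m p

theorem mem_irrel_pow_of_isHomogeneous {m : ℕ} {p : MvPolynomial ι k} (hp : p.IsHomogeneous m) :
    p ∈ irrel k ι ^ m :=
  mem_irrel_pow.2 fun _ hx => by
    have := hp (mem_support_iff.1 hx)
    exact ((DFunLike.congr_fun (Finsupp.degree_eq_weight_one (R := ℕ)) _).trans this).ge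

theorem HFq_eq_zero_iff {J : Ideal (MvPolynomial ι k)} {m : ℕ} :
    HFq k J m = 0 ↔ ∀ p : MvPolynomial ι k, p.IsHomogeneous m → p ∈ J := by
  rw [HFq, Submodule.finrank_eq_zero, Submodule.eq_bot_iff]
  constructor
  · intro h p hp
    exact Ideal.Quotient.eq_zero_iff_mem.1 (h _ (mem_qComp.2 ⟨p, hp, rfl⟩))
  · rintro h x hx
    obtain ⟨p, hp, rfl⟩ := mem_qComp.1 hx
    exact Ideal.Quotient.eq_zero_iff_mem.2 (h p hp)

theorem HFq_eq_zero_iff_pow_le {J : Ideal (MvPolynomial ι k)} {m : ℕ} :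
    HFq k J m = 0 ↔ irrel k ι ^ m ≤ J := by
  rw [HFq_eq_zero_iff]
  refine ⟨fun h => ?_, fun h p hp => h (mem_irrel_pow_of_isHomogeneous hp)⟩
  refine (pow_idealOfVars_eq_span (σ := ι) (R := k) m).le.trans (Ideal.span_le.2 ?_)
  rintro _ ⟨x, hx, rfl⟩
  exact h _ (isHomogeneous_monomial _ hx)

theorem HFq_eq_zero_of_le {J : Ideal (MvPolynomial ι k)} {m m' : ℕ} (h : HFq k J m = 0)
    (hm : m ≤ m') : HFq k J m' = 0 :=
  HFq_eq_zero_iff_pow_le.2 ((Ideal.pow_le_pow_right hm).trans (HFq_eq_zero_iff_pow_le.1 h))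

theorem Homog.exists_HFq_eq_zero {J : Ideal (MvPolynomial ι k)} (hJ : Homog J)
    (h : IsArtinianRing (MvPolynomial ι k ⧸ J)) : ∃ N, HFq k J N = 0 := by
  let f : ℕ →o (Ideal (MvPolynomial ι k ⧸ J))ᵒᵈ :=
    ⟨fun m => OrderDual.toDual ((irrel k ι ^ m).map (Ideal.Quotient.mk J)), fun a b hab =>
      OrderDual.toDual_le_toDual.2 (Ideal.map_mono (Ideal.pow_le_pow_right hab))⟩
  obtain ⟨N, hN⟩ := IsArtinian.monotone_stabilizes f
  have h1 : (irrel k ι ^ N).map (Ideal.Quotient.mk J) =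
      (irrel k ι ^ (N + 1)).map (Ideal.Quotient.mk J) := hN (N + 1) (Nat.le_succ N)
  refine ⟨N, HFq_eq_zero_iff.2 fun p hp => ?_⟩
  have h2 : Ideal.Quotient.mk J p ∈ (irrel k ι ^ (N + 1)).map (Ideal.Quotient.mk J) :=
    h1 ▸ Ideal.mem_map_of_mem _ (mem_irrel_pow_of_isHomogeneous hp)
  obtain ⟨a, ha, hap⟩ := (Ideal.mem_map_iff_of_surjective _ Ideal.Quotient.mk_surjective).1 h2
  have h3 := hJ _ (Ideal.Quotient.eq.1 hap) N
  have ha0 : homogeneousComponent N a = 0 := by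
    rw [homogeneousComponent_apply]
    refine Finset.sum_eq_zero fun x hx => ?_
    have := mem_irrel_pow.1 ha x (Finset.mem_filter.1 hx).1
    have := (Finset.mem_filter.1 hx).2
    omega
  have hp0 := homogeneousComponent_of_mem (m := N) hp
  rw [if_pos rfl] at hp0
  rw [map_sub, ha0, hp0, zero_sub] at h3
  exact neg_mem_iff.1 h3

theorem Homog.sup_ofList {J : Ideal (MvPolynomial ι k)} (hJ : Homog J) (cs : List (ι → k)) :
    Homog (J ⊔ Ideal.ofList (cs.map (linForm k))) :=
  hJ.sup (homog_span fun p hp => by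
    obtain ⟨c, -, rfl⟩ := List.mem_map.1 hp
    exact ⟨1, isHomogeneous_linForm c⟩)

theorem RegSeq.exists_HFq_eq_zero {J : Ideal (MvPolynomial ι k)} (hJ : Homog J)
    {cs : List (ι → k)} (h : RegSeq J (cs.map (linForm k)))
    (hdim : ringKrullDim (MvPolynomial ι k ⧸ J) ≤ cs.length) :
    ∃ N, HFq k (J ⊔ Ideal.ofList (cs.map (linForm k))) N = 0 := by
  refine (hJ.sup_ofList cs).exists_HFq_eq_zero
    (isArtinianRing_iff_krullDimLE_zero.2 (Ring.krullDimLE_iff.2 ?_))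
  have h1 := (ringKrullDim_quotient_sup_ofList_add_length_le h).trans hdim
  rw [List.length_map] at h1
  generalize ringKrullDim (MvPolynomial ι k ⧸ J ⊔ Ideal.ofList (cs.map (linForm k))) = r at h1
  induction r with
  | bot => exact bot_le
  | coe r =>
    induction r with
    | top => 
      have h2 : (((⊤ : ℕ∞) + cs.length : ℕ∞) : WithBot ℕ∞) ≤ ((cs.length : ℕ∞) : WithBot ℕ∞) := h1
      rw [WithBot.coe_le_coe] at h2
      simp at h2
    | coe r =>
      have h2 : r + cs.length ≤ cs.length := by exact_mod_cast h1
      have h3 : r = 0 := by omega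
      subst h3
      exact le_of_eq rfl

theorem redIdeal_eq_sup_ofList (J : Ideal (MvPolynomial ι k)) {d : ℕ} (v : Fin d × ι → k) :
    redIdeal k J v =
      J ⊔ Ideal.ofList ((List.ofFn fun j i => v (j, i)).map (linForm k)) := by
  rw [redIdeal, Ideal.ofList]
  congr 2
  ext p
  simp [List.mem_ofFn, eq_comm]

end Vanishing

section Semicontinuity

variable {k}

theorem mem_redIdeal {J : Ideal (MvPolynomial ι k)} {d : ℕ} {v : Fin d × ι → k}
    {p : MvPolynomial ι k} : p ∈ redIdeal k J v ↔
      ∃ j ∈ J, ∃ a : Fin d → MvPolynomial ι k, j + ∑ s, a s * linForm k (fun i => v (s, i)) = p := by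
  rw [redIdeal, Submodule.mem_sup]
  refine exists_congr fun j => and_congr_right fun _ => ?_
  constructor
  · rintro ⟨z, hz, rfl⟩
    obtain ⟨a, rfl⟩ := Ideal.mem_span_range_iff_exists_fun.1 hz
    exact ⟨a, rfl⟩
  · rintro ⟨a, rfl⟩
    exact ⟨_, Ideal.mem_span_range_iff_exists_fun.2 ⟨a, rfl⟩, rfl⟩

/-- The degree `m` part of the ideal `J`, inside the space of forms of degree `m`. -/
def idealComp (J : Ideal (MvPolynomial ι k)) (m : ℕ) : Submodule k (homogeneousSubmodule ι k m) :=
  LinearMap.ker ((Ideal.Quotient.mkₐ k J).toLinearMap.domRestrict (homogeneousSubmodule ι k m))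

theorem mem_idealComp {J : Ideal (MvPolynomial ι k)} {m : ℕ} {x : homogeneousSubmodule ι k m} :
    x ∈ idealComp J m ↔ (x : MvPolynomial ι k) ∈ J :=
  LinearMap.mem_ker.trans Ideal.Quotient.eq_zero_iff_mem

theorem HFq_add_finrank_idealComp (J : Ideal (MvPolynomial ι k)) (m : ℕ) :
    HFq k J m + Module.finrank k (idealComp J m) =
      Module.finrank k (homogeneousSubmodule ι k m) := by
  have := LinearMap.finrank_range_add_finrank_ker
    ((Ideal.Quotient.mkₐ k J).toLinearMap.domRestrict (homogeneousSubmodule ι k m))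
  rwa [LinearMap.range_domRestrict] at this

/-- The projection to the space of forms of degree `m`. -/
def compMap (m : ℕ) : MvPolynomial ι k →ₗ[k] homogeneousSubmodule ι k m :=
  (homogeneousComponent m).codRestrict _ fun p => homogeneousComponent_isHomogeneous m p

theorem compMap_coe {m : ℕ} (x : homogeneousSubmodule ι k m) :
    compMap m (x : MvPolynomial ι k) = x :=
  Subtype.ext ((homogeneousComponent_of_mem x.2).trans (if_pos rfl))

/-- The Hilbert function of the quotient by linear forms is upper semicontinuous in the forms. -/
theorem Homog.HFq_redIdeal_semicontinuous {J : Ideal (MvPolynomial ι k)} (hJ : Homog J) {d : ℕ}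
    (v₀ : Fin d × ι → k) (m : ℕ) : ∃ g : MvPolynomial (Fin d × ι) k, eval v₀ g ≠ 0 ∧
      ∀ v, eval v g ≠ 0 → HFq k (SRWLP.redIdeal k J v) m ≤ HFq k (SRWLP.redIdeal k J v₀) m := by
  classical
  set r := Module.finrank k (idealComp (SRWLP.redIdeal k J v₀) m) with hr
  have := Module.Free.of_divisionRing k (idealComp (SRWLP.redIdeal k J v₀) m)
  let b := Module.finBasis k (idealComp (SRWLP.redIdeal k J v₀) m)
  have hb : ∀ a, ((b a : homogeneousSubmodule ι k m) : MvPolynomial ι k) ∈ SRWLP.redIdeal k J v₀ :=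
    fun a => mem_idealComp.1 (b a).2
  choose j hj p hp using fun a => mem_redIdeal.1 (hb a)
  let u : Fin r → (Fin d × ι → k) → homogeneousSubmodule ι k m := fun a v =>
    compMap m (j a + ∑ s, p a s * linForm k (fun i => v (s, i)))
  have hu₀ : ∀ a, u a v₀ = b a := fun a => by
    simp only [u]
    rw [hp a, compMap_coe]
  have hu : ∀ a v, u a v ∈ idealComp (SRWLP.redIdeal k J v) m := fun a v =>
    mem_idealComp.2 (hJ.redIdeal v _ (mem_redIdeal.2 ⟨_, hj a, _, rfl⟩) m)
  have hli : LinearIndependent k fun a => (b a : homogeneousSubmodule ι k m) :=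
    b.linearIndependent.map' (Submodule.subtype _) (Submodule.ker_subtype _)
  obtain ⟨Φ, hΦ⟩ := LinearMap.exists_leftInverse_of_injective
    (Fintype.linearCombination k fun a => (b a : homogeneousSubmodule ι k m))
    (LinearMap.ker_eq_bot.2 hli.fintypeLinearCombination_injective)
  have hΦb : ∀ a, Φ (b a) = Pi.single a 1 := fun a => by
    have := LinearMap.congr_fun hΦ (Pi.single a 1)
    simpa [Fintype.linearCombination_apply_single] using this
  let P : Matrix (Fin r) (Fin r) (MvPolynomial (Fin d × ι) k) := Matrix.of fun a a' =>
    C (Φ (compMap m (j a)) a') +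
      ∑ s, ∑ i, X (s, i) * C (Φ (compMap m (p a s * X i)) a')
  have hP : ∀ v, (eval v).mapMatrix P = Matrix.of fun a => Φ (u a v) := by
    intro v
    ext a a'
    rw [Matrix.of_apply]
    simp only [u]
    have e : j a + ∑ s, p a s * linForm k (fun i => v (s, i)) =
        j a + ∑ s, ∑ i, v (s, i) • (p a s * X i) := by
      congr 1
      refine Finset.sum_congr rfl fun s _ => ?_
      rw [linForm, Finset.mul_sum]
      refine Finset.sum_congr rfl fun i _ => ?_
      rw [smul_eq_C_mul]
      ring
    rw [e]
    simp only [RingHom.mapMatrix_apply, Matrix.map_apply, Matrix.of_apply, P, map_add,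
      map_sum, map_mul, eval_C, eval_X, map_smul, Pi.add_apply, Finset.sum_apply, Pi.smul_apply,
      smul_eq_mul]
  refine ⟨P.det, ?_, fun v hv => ?_⟩
  · rw [RingHom.map_det, hP]
    have : (Matrix.of fun a => Φ (u a v₀)) = 1 := by
      ext a a'
      rw [Matrix.of_apply, hu₀, hΦb, Matrix.one_apply, Pi.single_apply]
      simp only [eq_comm]
    rw [this, Matrix.det_one]
    exact one_ne_zero
  · rw [RingHom.map_det, hP] at hv
    have h1 : LinearIndependent k fun a => Φ (u a v) :=
      Matrix.linearIndependent_rows_iff_isUnit.2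
        ((Matrix.isUnit_iff_isUnit_det _).2 (isUnit_iff_ne_zero.2 hv))
    have h2 : LinearIndependent k fun a => u a v := h1.of_comp Φ
    have h3 : LinearIndependent k fun a =>
        (⟨u a v, hu a v⟩ : idealComp (SRWLP.redIdeal k J v) m) :=
      LinearIndependent.of_comp (Submodule.subtype _) h2
    have h4 := h3.fintype_card_le_finrank
    rw [Fintype.card_fin, hr] at h4
    have h5 := HFq_add_finrank_idealComp (SRWLP.redIdeal k J v) m
    have h6 := HFq_add_finrank_idealComp (SRWLP.redIdeal k J v₀) m
    omega

end Semicontinuity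

section GenericWLP

variable {k}

theorem eval_bind₁_eq {τ τ' : Type} (a : τ' → MvPolynomial τ k) (g : MvPolynomial τ' k)
    (c : τ → k) : eval c (bind₁ a g) = eval (fun x => eval c (a x)) g := by
  simp only [eval, eval₂Hom_bind₁]

theorem exists_eval_ne_zero [Infinite k] {τ : Type} {g : MvPolynomial τ k} (hg : g ≠ 0) :
    ∃ c, eval c g ≠ 0 := by
  by_contra! h
  exact hg (MvPolynomial.funext fun c => by rw [h c, map_zero])

theorem ne_zero_of_eval_ne_zero {τ : Type} {g : MvPolynomial τ k} {c : τ → k}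
    (h : eval c g ≠ 0) : g ≠ 0 := by
  rintro rfl
  exact h (map_zero _)

theorem Homog.HFq_redIdeal_le_open {J : Ideal (MvPolynomial ι k)} (hJ : Homog J) {d : ℕ}
    (v₀ : Fin d × ι → k) {N : ℕ} (hN : HFq k (SRWLP.redIdeal k J v₀) N = 0) :
    ∃ g : MvPolynomial (Fin d × ι) k, eval v₀ g ≠ 0 ∧
      ∀ v, eval v g ≠ 0 → ∀ m, HFq k (SRWLP.redIdeal k J v) m ≤
        HFq k (SRWLP.redIdeal k J v₀) m := by
  choose g hg hgv using hJ.HFq_redIdeal_semicontinuous v₀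
  refine ⟨∏ m ∈ Finset.range (N + 1), g m, ?_, fun v hv m => ?_⟩
  · rw [map_prod]
    exact Finset.prod_ne_zero_iff.2 fun m _ => hg m
  · rw [map_prod] at hv
    have hv' : ∀ m ≤ N, eval v (g m) ≠ 0 := fun m hm =>
      Finset.prod_ne_zero_iff.1 hv m (Finset.mem_range.2 (Nat.lt_succ_of_le hm))
    rcases le_total m N with hm | hm
    · exact hgv m v (hv' m hm)
    · have h0 := hgv N v (hv' N le_rfl)
      rw [hN, Nat.le_zero] at h0
      rw [HFq_eq_zero_of_le h0 hm]
      exact Nat.zero_le _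

theorem redIdeal_succ (J : Ideal (MvPolynomial ι k)) {d : ℕ} (w : Fin (d + 1) × ι → k) :
    redIdeal k J w = redIdeal k J (fun x : Fin d × ι => w (x.1.succ, x.2)) ⊔
      Ideal.span {linForm k fun i => w (0, i)} := by
  rw [redIdeal, redIdeal, sup_assoc, ← Ideal.span_union, Set.union_singleton, ← Fin.range_cons]
  congr 3
  ext j : 1
  induction j using Fin.cases <;> rfl

/-- The tuple of linear forms obtained by prepending the linear form `e` to `v`. -/
def consForm {d : ℕ} (e : ι → k) (v : Fin d × ι → k) : Fin (d + 1) × ι → k := fun x =>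
  Fin.cases (e x.2) (fun j => v (j, x.2)) x.1

theorem redIdeal_consForm (J : Ideal (MvPolynomial ι k)) {d : ℕ} (e : ι → k)
    (v : Fin d × ι → k) :
    redIdeal k J (consForm e v) = redIdeal k J v ⊔ Ideal.span {linForm k e} := redIdeal_succ _ _

/-- The quotient of `k[X] ⧸ J` by the linear forms `v` has Hilbert function `h`. -/
def HasHF (J : Ideal (MvPolynomial ι k)) (h : ℕ → ℕ) {d : ℕ} (v : Fin d × ι → k) : Prop :=
  ∀ m, HFq k (redIdeal k J v) m = h m

/-- The quotient of `k[X] ⧸ J` by the linear forms `w` has the Hilbert function expected from the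
weak Lefschetz property for an algebra with Hilbert function `h`. -/
def HasWLPHF (J : Ideal (MvPolynomial ι k)) (h : ℕ → ℕ) {d : ℕ} (w : Fin d × ι → k) : Prop :=
  ∀ m, HFq k (redIdeal k J w) (m + 1) ≤ h (m + 1) - h m

/-- `h` is the smallest Hilbert function of a quotient of `k[X] ⧸ J` by `d` linear forms,
and vanishes eventually. -/
structure MinHF (J : Ideal (MvPolynomial ι k)) (d : ℕ) (h : ℕ → ℕ) : Prop where
  homog : Homog J
  eq_of_le : ∀ v : Fin d × ι → k, (∀ m, HFq k (redIdeal k J v) m ≤ h m) → HasHF J h v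
  eventually_zero : ∃ N, h N = 0

theorem MinHF.hasHF_open {J : Ideal (MvPolynomial ι k)} {d : ℕ} {h : ℕ → ℕ} (H : MinHF J d h)
    {v₀ : Fin d × ι → k} (hv₀ : HasHF J h v₀) :
    ∃ g : MvPolynomial (Fin d × ι) k, eval v₀ g ≠ 0 ∧ ∀ v, eval v g ≠ 0 → HasHF J h v := by
  obtain ⟨N, hN⟩ := H.eventually_zero
  obtain ⟨g, hg, hgv⟩ := H.homog.HFq_redIdeal_le_open v₀ ((hv₀ N).trans hN)
  exact ⟨g, hg, fun v hv => H.eq_of_le v fun m => (hgv v hv m).trans (hv₀ m).le⟩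

theorem MinHF.hasWLPHF_open {J : Ideal (MvPolynomial ι k)} {d : ℕ} {h : ℕ → ℕ} (H : MinHF J d h)
    {v₀ : Fin d × ι → k} (hv₀ : HasHF J h v₀) {e₀ : ι → k} (hw : HasWLPHF J h (consForm e₀ v₀)) :
    ∃ g : MvPolynomial (Fin (d + 1) × ι) k, eval (consForm e₀ v₀) g ≠ 0 ∧
      ∀ w, eval w g ≠ 0 → HasWLPHF J h w := by
  obtain ⟨N, hN⟩ := H.eventually_zero
  have h0 : HFq k (redIdeal k J (consForm e₀ v₀)) N = 0 := by
    rw [HFq_eq_zero_iff_pow_le, redIdeal_consForm]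
    exact le_sup_of_le_left (HFq_eq_zero_iff_pow_le.1 ((hv₀ N).trans hN))
  obtain ⟨g, hg, hgv⟩ := H.homog.HFq_redIdeal_le_open _ h0
  exact ⟨g, hg, fun w hw' m => (hgv w hw' _).trans (hw m)⟩

theorem MinHF.forall_mulMaxRank_iff {J : Ideal (MvPolynomial ι k)} {d : ℕ} {h : ℕ → ℕ}
    (H : MinHF J d h) {v : Fin d × ι → k} (hv : HasHF J h v) (e : ι → k) :
    (∀ m, mulMaxRank k (redIdeal k J v) (Ideal.Quotient.mk _ (linForm k e)) m) ↔
      HasWLPHF J h (consForm e v) := by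
  refine forall_congr' fun m => ?_
  rw [(H.homog.redIdeal v).mulMaxRank_iff, hv, hv, redIdeal_consForm]

/-- In a polynomial family of linear forms, the weak Lefschetz property of a general quotient is
witnessed by a single member of the family. -/
theorem MinHF.generic_artWLP_iff [Infinite k] {J : Ideal (MvPolynomial ι k)} {d : ℕ} {h : ℕ → ℕ}
    (H : MinHF J d h) {τ : Type} (a : Fin d × ι → MvPolynomial τ k)
    (h₀ : ∃ c, HasHF J h fun x => eval c (a x)) :
    Generic k τ (fun c => artWLP k (redIdeal k J fun x => eval c (a x))) ↔
      ∃ c e, HasHF J h (fun x => eval c (a x)) ∧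
        HasWLPHF J h (consForm e fun x => eval c (a x)) := by
  constructor
  · rintro ⟨g, hg, hgc⟩
    obtain ⟨c₀, hc₀⟩ := h₀
    obtain ⟨g₁, hg₁, hgv⟩ := H.hasHF_open hc₀
    rw [← eval_bind₁_eq] at hg₁
    obtain ⟨c, hc⟩ := exists_eval_ne_zero (mul_ne_zero hg (ne_zero_of_eval_ne_zero hg₁))
    rw [map_mul] at hc
    obtain ⟨g₂, hg₂, he⟩ := hgc c (left_ne_zero_of_mul hc)
    have hc' := hgv _ (by rw [← eval_bind₁_eq]; exact right_ne_zero_of_mul hc)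
    obtain ⟨e, hee⟩ := exists_eval_ne_zero hg₂
    exact ⟨c, e, hc', (H.forall_mulMaxRank_iff hc' e).1 (he e hee)⟩
  · rintro ⟨c₁, e₁, hc₁, hw₁⟩
    obtain ⟨g, hg, hgv⟩ := H.hasHF_open hc₁
    obtain ⟨G, hG, hGw⟩ := H.hasWLPHF_open hc₁ hw₁
    let b : Fin (d + 1) × ι → MvPolynomial τ k := fun x =>
      Fin.cases (C (e₁ x.2)) (fun j => a (j, x.2)) x.1
    have hb : ∀ c, (fun x => eval c (b x)) = consForm e₁ fun x => eval c (a x) := by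
      intro c
      funext ⟨j, i⟩
      induction j using Fin.cases with
      | zero => exact eval_C _
      | succ j => rfl
    rw [← eval_bind₁_eq] at hg
    rw [← hb, ← eval_bind₁_eq] at hG
    refine ⟨bind₁ a g * bind₁ b G, ne_zero_of_eval_ne_zero (c := c₁) ?_, fun c hc => ?_⟩
    · rw [map_mul]
      exact mul_ne_zero hg hG
    · rw [map_mul, eval_bind₁_eq, eval_bind₁_eq, hb] at hc
      have hc' := hgv _ (left_ne_zero_of_mul hc)
      let b' : Fin (d + 1) × ι → MvPolynomial ι k := fun x =>
        Fin.cases (X x.2) (fun j => C (eval c (a (j, x.2)))) x.1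
      have hb' : ∀ e, (fun x => eval e (b' x)) = consForm e fun x => eval c (a x) := by
        intro e
        funext ⟨j, i⟩
        induction j using Fin.cases with
        | zero => exact eval_X _
        | succ j => exact eval_C _
      refine ⟨bind₁ b' G, ne_zero_of_eval_ne_zero (c := e₁) ?_, fun e he => ?_⟩
      · rw [eval_bind₁_eq, hb']
        exact right_ne_zero_of_mul hc
      · rw [eval_bind₁_eq, hb'] at he
        exact (H.forall_mulMaxRank_iff hc' e).2 (hGw _ he)

theorem RegSeq.minHF {J : Ideal (MvPolynomial ι k)} (hJ : Homog J) {cs : List (ι → k)}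
    (h : RegSeq J (cs.map (linForm k)))
    (hdim : ringKrullDim (MvPolynomial ι k ⧸ J) ≤ cs.length) :
    MinHF J cs.length (HFq k (J ⊔ Ideal.ofList (cs.map (linForm k)))) where
  homog := hJ
  eq_of_le v hv m := by
    rw [redIdeal_eq_sup_ofList] at hv ⊢
    exact hJ.HFq_eq_of_le h List.length_ofFn hv m
  eventually_zero := h.exists_HFq_eq_zero hJ hdim

/-- Eliminating the last variable from the forms `w (j + 1, ·)` by means of `w (0, ·)`. -/
def elimLast {d : ℕ} (w : Fin (d + 1) × Fin (n + 1) → k) : Fin d × Fin (n + 1) → k := fun x =>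
  w (0, Fin.last n) * w (x.1.succ, x.2) - w (x.1.succ, Fin.last n) * w (0, x.2)

theorem redIdeal_elimLast (J : Ideal (MvPolynomial (Fin (n + 1)) k)) {d : ℕ}
    {w : Fin (d + 1) × Fin (n + 1) → k} (hw : w (0, Fin.last n) ≠ 0) :
    redIdeal k J (consForm (fun i => w (0, i)) (elimLast w)) = redIdeal k J w := by
  rw [redIdeal_consForm, redIdeal_succ, redIdeal, redIdeal]
  set e : Fin (n + 1) → k := fun i => w (0, i)
  have key : ∀ j : Fin d, linForm k (fun i => elimLast w (j, i)) =
      C (w (0, Fin.last n)) * linForm k (fun i => w (j.succ, i)) -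
        C (w (j.succ, Fin.last n)) * linForm k e := by
    intro j
    have : (fun i => elimLast w (j, i)) = w (0, Fin.last n) • (fun i => w (j.succ, i)) +
        (-w (j.succ, Fin.last n)) • e := by
      funext i
      simp [elimLast, e, sub_eq_add_neg]
    rw [this, linForm_add, linForm_smul, linForm_smul, map_neg]
    ring
  have he : ∀ K : Ideal (MvPolynomial (Fin (n + 1)) k), linForm k e ∈ K ⊔ Ideal.span {linForm k e} :=
    fun K => Ideal.mem_sup_right (Ideal.mem_span_singleton_self _)
  apply le_antisymm
  · refine sup_le (sup_le (le_sup_of_le_left le_sup_left) (Ideal.span_le.2 ?_)) le_sup_right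
    rintro _ ⟨j, rfl⟩
    simp only [key]
    exact sub_mem (Ideal.mul_mem_left _ _ (Ideal.mem_sup_left (Ideal.mem_sup_right
      (Ideal.subset_span ⟨j, rfl⟩)))) (Ideal.mul_mem_left _ _ (he _))
  · refine sup_le (sup_le (le_sup_of_le_left le_sup_left) (Ideal.span_le.2 ?_)) le_sup_right
    rintro _ ⟨j, rfl⟩
    have h1 : linForm k (fun i => w (j.succ, i)) = C (w (0, Fin.last n))⁻¹ *
        (linForm k (fun i => elimLast w (j, i)) + C (w (j.succ, Fin.last n)) * linForm k e) := by
      rw [key, sub_add_cancel, ← mul_assoc, ← C_mul, inv_mul_cancel₀ hw, C_1, one_mul]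
    simp only [h1]
    exact Ideal.mul_mem_left _ _ (add_mem (Ideal.mem_sup_left (Ideal.mem_sup_right
      (Ideal.subset_span ⟨j, rfl⟩))) (Ideal.mul_mem_left _ _ (he _)))

/-- Coefficients of forms not involving the last variable. -/
def extForms {d : ℕ} (c : Fin d × Fin n → k) : Fin d × Fin (n + 1) → k := fun x =>
  Fin.lastCases (motive := fun _ => k) 0 (fun i => c (x.1, i)) x.2

theorem extForms_eq {d : ℕ} {v : Fin d × Fin (n + 1) → k} (hv : ∀ j, v (j, Fin.last n) = 0) :
    extForms (fun x => v (x.1, x.2.castSucc)) = v := by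
  funext ⟨j, i⟩
  induction i using Fin.lastCases <;> simp [extForms, hv]

theorem sup_xForms (J : Ideal (MvPolynomial (Fin (n + 1)) k)) {d : ℕ} (c : Fin d × Fin n → k) :
    J ⊔ xForms k c = redIdeal k J (extForms c) := by
  rw [redIdeal, xForms]
  simp only [toT_linForm]
  congr 4
  funext j
  congr 1
  funext i
  induction i using Fin.lastCases <;> simp [extForms]

/-- If some forms free of the last variable attain the minimal Hilbert function, general forms can
be replaced by general forms free of the last variable. -/
theorem MinHF.generic_artWLP_xForms_iff [Infinite k] {J : Ideal (MvPolynomial (Fin (n + 1)) k)}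
    {d : ℕ} {h : ℕ → ℕ} (H : MinHF J d h) (h₀ : ∃ c : Fin d × Fin n → k, HasHF J h (extForms c)) :
    Generic k (Fin d × Fin (n + 1)) (fun c => artWLP k (redIdeal k J c)) ↔
      Generic k (Fin d × Fin n) fun c => artWLP k (J ⊔ xForms k c) := by
  obtain ⟨c₀, hc₀⟩ := h₀
  have h1 := H.generic_artWLP_iff (τ := Fin d × Fin (n + 1)) X ⟨extForms c₀, by simpa using hc₀⟩
  let a : Fin d × Fin (n + 1) → MvPolynomial (Fin d × Fin n) k := fun x =>
    Fin.lastCases (motive := fun _ => MvPolynomial (Fin d × Fin n) k) 0 (fun i => X (x.1, i)) x.2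
  have ha : ∀ c, (fun x => eval c (a x)) = extForms c := by
    intro c
    funext ⟨j, i⟩
    induction i using Fin.lastCases <;> simp [extForms, a]
  have h2 := H.generic_artWLP_iff a ⟨c₀, by rwa [ha]⟩
  simp only [ha] at h2
  simp only [eval_X] at h1
  simp only [sup_xForms]
  rw [h1, h2]
  constructor
  · rintro ⟨v₁, e₁, hv₁, hw₁⟩
    obtain ⟨g, hg, hgv⟩ := H.hasHF_open hc₀
    obtain ⟨G, hG, hGw⟩ := H.hasWLPHF_open hv₁ hw₁
    let b : Fin d × Fin (n + 1) → MvPolynomial (Fin (d + 1) × Fin (n + 1)) k := fun x =>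
      X (0, Fin.last n) * X (x.1.succ, x.2) - X (x.1.succ, Fin.last n) * X (0, x.2)
    have hb : ∀ w, (fun x => eval w (b x)) = elimLast w := by
      intro w
      funext x
      simp [b, elimLast]
    have he : elimLast (consForm (Pi.single (Fin.last n) 1) (extForms c₀)) = extForms c₀ := by
      funext ⟨j, i⟩
      simp [elimLast, consForm, extForms]
    have hg' : bind₁ b g ≠ 0 := ne_zero_of_eval_ne_zero
      (c := consForm (Pi.single (Fin.last n) 1) (extForms c₀)) (by
        rwa [eval_bind₁_eq, hb, he])
    obtain ⟨w, hw⟩ := exists_eval_ne_zero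
      (mul_ne_zero (mul_ne_zero hg' (ne_zero_of_eval_ne_zero hG)) (X_ne_zero (0, Fin.last n)))
    rw [map_mul, map_mul, eval_bind₁_eq, hb, eval_X] at hw
    have hw0 := right_ne_zero_of_mul hw
    have hext : extForms (fun x => elimLast w (x.1, x.2.castSucc)) = elimLast w :=
      extForms_eq fun j => by simp [elimLast, mul_comm]
    refine ⟨fun x => elimLast w (x.1, x.2.castSucc), fun i => w (0, i), ?_, ?_⟩
    · rw [hext]
      exact hgv _ (left_ne_zero_of_mul (left_ne_zero_of_mul hw))
    · intro m
      rw [hext, redIdeal_elimLast J hw0]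
      exact hGw w (right_ne_zero_of_mul (left_ne_zero_of_mul hw)) m
  · rintro ⟨c, e, hc, hw⟩
    exact ⟨extForms c, e, hc, hw⟩

end GenericWLP

section Main

variable {k}

theorem generic_artWLP_IC_iff [Infinite k] {D : SC n} {σ : Finset (Fin n)} (hσ : σ ∈ D.faces)
    (q : ℕ) {d : ℕ} (h : isCM k (srIdeal k D) d) :
    Generic k (Fin d × Fin (n + 1)) (fun c => artWLP k (redIdeal k (IC k D σ q) c)) ↔
      Generic k (Fin d × Fin n) fun c => artWLP k (IC k D σ q ⊔ xForms k c) := by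
  obtain ⟨cs, rfl, hcs⟩ := exists_regSeq_IC hσ q h
  have hmin := hcs.minHF (homog_IC D σ q) (by
    rw [List.length_map]
    exact (isCM_IC hσ q h).1.le)
  rw [List.length_map] at hmin
  refine hmin.generic_artWLP_xForms_iff ⟨fun x => cs.get x.1 x.2, fun m => ?_⟩
  rw [redIdeal_eq_sup_ofList]
  congr 4
  refine List.ext_get (by simp) fun i _ _ => ?_
  simp only [List.get_eq_getElem, List.getElem_ofFn, List.getElem_map]
  funext j
  induction j using Fin.lastCases <;> simp [extForms]

end Main

/-- **Lemma.** `k[D]` has the WLP iff `A` has the WLP; `k[L]` (equivalently `R/I_L`)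
has the WLP iff `B` has the WLP; `R[T]/I_C` has the WLP iff `C` has the WLP. -/
theorem wlp_iff_artinian_reduction (k : Type) [Field k] [Infinite k]
    (n q d : ℕ) (hq : 1 ≤ q)
    (D : SC n) (hD : gorStar k D)
    (σ : Finset (Fin n)) (hσ : σ ∈ D.faces) (hcard : σ.card = q + 1)
    (hd : d = dimP D) :
    (hasWLP k (srIdeal k D) d ↔
      Generic k (Fin d × Fin n) fun c => artWLP k (redIdeal k (srIdeal k D) c)) ∧
    (hasWLP k (linkIdeal k D σ) d ↔
      Generic k (Fin d × Fin n) fun c => artWLP k (redIdeal k (linkIdeal k D σ) c)) ∧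
    (hasWLP k (IC k D σ q) d ↔
      Generic k (Fin d × Fin n) fun c => artWLP k (IC k D σ q ⊔ xForms k c)) := by
  subst hd
  have hcm : isCM k (srIdeal k D) (dimP D) := hD.2.1.1
  refine ⟨and_iff_right hcm, and_iff_right (isCM_linkIdeal hσ hcm), ?_⟩
  exact (and_iff_right (isCM_IC hσ q hcm)).trans (generic_artWLP_IC_iff hσ q hcm)

end SRWLP
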